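/- Let d ≥ 1, 2 ≤ p < ∞ and r > 1/p. There is a constant C (depending only on d, p, r) such that for all n ∈ ℕ and all 1 ≤ m ≤ |Q_n|, the Kolmogorov numbers of the de la Vallée Poussin hyperbolic layer operator on the Hölder–Nikolskii space satisfy d_m(A_{ΔQ_n} : B^r_{p,∞}(𝕋^d) → L_∞(𝕋^d)) ≤ C 2^{−rn} (2^n/m)^{1/p} n^{d−1 + 1/p}. -/

import Mathlib

open MeasureTheory Real
open scoped ENNReal ComplexConjugate Classical

noncomputable section

instance : Fact (0 < 2 * π) := ⟨by positivity⟩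

/-- The `d`-dimensional torus `[0, 2π]^d`. -/
abbrev Torus (d : ℕ) := Fin d → AddCircle (2 * π)

/-- The multivariate trigonometric character `x ↦ e^{i k · x}`. -/
def trigChar {d : ℕ} (k : Fin d → ℤ) : C(Torus d, ℂ) :=
  ⟨fun x => ∏ j, fourier (k j) (x j),
    continuous_finset_prod _ fun j _ => (map_continuous (fourier (k j))).comp (continuous_apply j)⟩

/-- The Fourier coefficient `f̂(k) = (2π)^{-d} ∫ f(x) e^{-i k·x} dx`. -/
def fCoeff {d : ℕ} (f : Torus d → ℂ) (k : Fin d → ℤ) : ℂ :=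
  ((2 * π) ^ d)⁻¹ • ∫ x : Torus d, conj (trigChar k x) * f x

/-- A continuous function on the torus, considered as an element of `L_∞`. -/
def toLinfty {d : ℕ} (g : C(Torus d, ℂ)) : Lp ℂ ∞ (volume : Measure (Torus d)) :=
  ContinuousMap.toLp ∞ (volume : Measure (Torus d)) ℂ g

/-- The dyadic block `ρ(s) = {k : ⌊2^{s_j - 1}⌋ ≤ |k_j| < 2^{s_j}, j = 1,…,d}`. -/
def inRho {d : ℕ} (s : Fin d → ℕ) (k : Fin d → ℤ) : Prop :=
  ∀ j, (2 ^ (s j) / 2 : ℤ) ≤ |k j| ∧ |k j| < 2 ^ (s j)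

/-- The step hyperbolic cross `Q_n = ⋃_{‖s‖₁ ≤ n} ρ(s)` as a finite set of frequencies. -/
def hypCross (d n : ℕ) : Finset (Fin d → ℤ) :=
  (Finset.Icc (fun _ => -(2 ^ n : ℤ)) fun _ => (2 ^ n : ℤ)).filter
    fun k => ∃ s : Fin d → ℕ, (∑ j, s j) ≤ n ∧ inRho s k

/-- The Fourier multiplier of the univariate de la Vallée Poussin kernel
`𝒱_m = (1/m) ∑_{l=m}^{2m-1} D_l`: it equals `1` for `|k| ≤ m`, `(2m - |k|)/m` for
`m ≤ |k| ≤ 2m` and `0` otherwise. -/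
def vpMult (m : ℕ) (k : ℤ) : ℝ :=
  min 1 (max 0 ((2 * (m : ℝ) - |(k : ℝ)|) / m))

/-- The Fourier multiplier of `𝒜_0 = 𝒱_1` and `𝒜_s = 𝒱_{2^s} - 𝒱_{2^{s-1}}` for `s ≥ 1`. -/
def aMult : ℕ → ℤ → ℝ
  | 0, k => vpMult 1 k
  | s + 1, k => vpMult (2 ^ (s + 1)) k - vpMult (2 ^ s) k

/-- The Fourier multiplier of the tensorized kernel `𝒜_s`, `s ∈ ℕ₀^d`. -/
def aMultd {d : ℕ} (s : Fin d → ℕ) (k : Fin d → ℤ) : ℝ :=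
  ∏ j, aMult (s j) (k j)

/-- The spectrum of `𝒜_s`. -/
def Abox (d : ℕ) (s : Fin d → ℕ) : Finset (Fin d → ℤ) :=
  Finset.Icc (fun j => -(2 ^ (s j + 1) : ℤ)) fun j => (2 ^ (s j + 1) : ℤ)

/-- The building block `A_s(f) = f ∗ 𝒜_s = ∑_k 𝒜̂_s(k) f̂(k) e^{i k·x}`. -/
def Asf {d : ℕ} (s : Fin d → ℕ) (f : Torus d → ℂ) : C(Torus d, ℂ) :=
  ∑ k ∈ Abox d s, ((aMultd s k : ℂ) * fCoeff f k) • trigChar k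

/-- The term `2^{r‖s‖₁} ‖A_s(f)‖_q` of the `B^r_{q,∞} = H^r_q` norm. -/
def hTerm (d : ℕ) (r : ℝ) (q : ℝ≥0∞) (f : Torus d → ℂ) (s : Fin d → ℕ) : ℝ :=
  (2 : ℝ) ^ (r * ∑ j, (s j : ℝ)) * (eLpNorm (⇑(Asf s f)) q volume).toReal

/-- The Hölder–Nikolskii space `H^r_p(𝕋^d) = B^r_{p,∞}(𝕋^d)` of functions `f ∈ L_p(𝕋^d)`
with finite norm `sup_{s ∈ ℕ₀^d} 2^{r‖s‖₁} ‖A_s(f)‖_p`. -/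
def HNikSpace (d : ℕ) (r : ℝ) (q : ℝ≥0∞) : Type :=
  {f : Lp ℂ q (volume : Measure (Torus d)) //
    BddAbove (Set.range (hTerm d r q (f : Torus d → ℂ)))}

noncomputable instance (d : ℕ) (r : ℝ) (q : ℝ≥0∞) : Norm (HNikSpace d r q) :=
  ⟨fun f => ⨆ s : Fin d → ℕ, hTerm d r q (f.1 : Torus d → ℂ) s⟩

/-- The operator `A_{ΔQ_n} = A_{Q_n} - A_{Q_{n-1}} = ∑_{‖s‖₁ = n} A_s`, as a map
`B^r_{p,∞}(𝕋^d) → L_∞(𝕋^d)`. -/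
def ADelta (d : ℕ) (r : ℝ) (q : ℝ≥0∞) (n : ℕ)
    (f : HNikSpace d r q) : Lp ℂ ∞ (volume : Measure (Torus d)) :=
  toLinfty (∑ s ∈ (Finset.Icc (0 : Fin d → ℕ) fun _ => n).filter
    (fun s => ∑ j, s j = n), Asf s (f.1 : Torus d → ℂ))

/-- Kolmogorov numbers. -/
noncomputable def dK {A B : Type*} [Norm A] [NormedAddCommGroup B] [NormedSpace ℂ B]
    (T : A → B) (m : ℕ) : ℝ :=
  ⨅ L : {L : Submodule ℂ B // FiniteDimensional ℂ L ∧ Module.finrank ℂ L < m},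
    ⨆ a : {a : A // ‖a‖ ≤ 1}, ⨅ b : L.1, ‖T a.1 - (b : B)‖

open scoped BigOperators

theorem sum_signs_prod {ι R : Type*} [Fintype ι] [DecidableEq ι] [CommSemiring R]
    (f : ι → ℤˣ → R) :
    ∑ ω : ι → ℤˣ, ∏ i, f i (ω i) = ∏ i, (f i 1 + f i (-1)) := by
  have h := (Finset.prod_univ_sum (fun _ : ι => (Finset.univ : Finset ℤˣ)) f).symm
  rw [Fintype.piFinset_univ] at h
  simpa [UnitsInt.univ] using h

theorem sum_signs_exp_le {ι : Type*} [Fintype ι] [DecidableEq ι] (x : ι → ℝ) :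
    ∑ ω : ι → ℤˣ, exp (∑ i, ((ω i : ℤ) : ℝ) * x i) ≤
      Fintype.card (ι → ℤˣ) * exp ((∑ i, x i ^ 2) / 2) := by
  have h := sum_signs_prod (fun i (u : ℤˣ) => exp (((u : ℤ) : ℝ) * x i))
  simp only [← exp_sum] at h
  rw [h]
  have hc : (Fintype.card (ι → ℤˣ) : ℝ) = ∏ _i : ι, (2 : ℝ) := by simp
  rw [hc, Finset.sum_div, exp_sum, ← Finset.prod_mul_distrib]
  refine Finset.prod_le_prod (fun i _ => by positivity) fun i _ => ?_
  have := cosh_le_exp_half_sq (x i)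
  rw [cosh_eq] at this
  simp
  linarith

theorem sum_signs_cos {ι : Type*} [Fintype ι] [DecidableEq ι] (x : ι → ℝ) :
    ∑ ω : ι → ℤˣ, cos (∑ i, ((ω i : ℤ) : ℝ) * x i) =
      Fintype.card (ι → ℤˣ) * ∏ i, cos (x i) := by
  have h := sum_signs_prod (fun i (u : ℤˣ) => Complex.exp ((((u : ℤ) : ℝ) * x i : ℝ) * Complex.I))
  simp only [← Complex.exp_sum, ← Finset.sum_mul, ← Complex.ofReal_sum] at h
  have h2 : ∀ i, Complex.exp (((((1 : ℤˣ) : ℤ) : ℝ) * x i : ℝ) * Complex.I) +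
      Complex.exp (((((-1 : ℤˣ) : ℤ) : ℝ) * x i : ℝ) * Complex.I) = ((2 * cos (x i) : ℝ) : ℂ) := by
    intro i
    push_cast
    rw [Complex.cos]
    simp
    ring_nf
  simp only [h2, ← Complex.ofReal_prod] at h
  have h3 := congrArg Complex.re h
  simp only [Complex.re_sum, Complex.exp_ofReal_mul_I_re, Complex.ofReal_re] at h3
  rw [h3, Finset.prod_mul_distrib]
  simp

/-- A weak form of the Khinchine inequality in `L₁`. -/
theorem khinchine_lower {ι : Type*} [Fintype ι] [DecidableEq ι] (x : ι → ℝ) :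
    Fintype.card (ι → ℤˣ) * (1 / 6 * √(∑ i, x i ^ 2)) ≤
      ∑ ω : ι → ℤˣ, |∑ i, ((ω i : ℤ) : ℝ) * x i| := by
  set N := √(∑ i, x i ^ 2) with hN
  have hN0 : 0 ≤ N := Real.sqrt_nonneg _
  have hNsq : N ^ 2 = ∑ i, x i ^ 2 := Real.sq_sqrt (Finset.sum_nonneg fun i _ => sq_nonneg _)
  rcases hN0.eq_or_lt with h0 | hpos
  · rw [← h0]
    simp only [mul_zero]
    exact Finset.sum_nonneg fun _ _ => abs_nonneg _
  have hsq : ∑ i, (x i / N) ^ 2 = 1 := by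
    simp only [div_pow, ← Finset.sum_div, ← hNsq]
    exact div_self (by positivity)
  have hle : ∀ i, |x i / N| ≤ 1 := by
    intro i
    rw [← sq_le_one_iff_abs_le_one, ← hsq]
    exact Finset.single_le_sum (f := fun i => (x i / N) ^ 2) (fun i _ => sq_nonneg _)
      (Finset.mem_univ i)
  have hcos := sum_signs_cos (fun i => x i / N)
  have hprod : ∏ i, cos (x i / N) ≤ 5 / 6 := by
    have h1 : ∏ i, cos (x i / N) ≤ ∏ i, exp (-(2 / π ^ 2 * (x i / N) ^ 2)) := by
      refine Finset.prod_le_prod (fun i _ => (cos_pos_of_le_one (hle i)).le) fun i _ => ?_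
      have h3 := add_one_le_exp (-(2 / π ^ 2 * (x i / N) ^ 2))
      have h4 := Real.cos_le_one_sub_mul_cos_sq (x := x i / N)
        ((hle i).trans (by linarith [pi_gt_three]))
      linarith
    refine h1.trans ?_
    rw [← exp_sum, Finset.sum_neg_distrib, ← Finset.mul_sum, hsq, mul_one]
    have hpi : (2 : ℝ) / 10 ≤ 2 / π ^ 2 := by
      have := pi_lt_d2
      have := pi_pos
      gcongr
      nlinarith
    have h5 : exp (-(2 / π ^ 2)) ≤ exp (-(1 / 5)) := exp_le_exp.2 (by linarith)
    refine h5.trans ?_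
    rw [exp_neg, inv_le_comm₀ (exp_pos _) (by norm_num)]
    have := add_one_le_exp (1 / 5 : ℝ)
    linarith
  have hterm : ∀ ω : ι → ℤˣ, N * (1 - cos (∑ i, ((ω i : ℤ) : ℝ) * (x i / N))) ≤
      |∑ i, ((ω i : ℤ) : ℝ) * x i| := by
    intro ω
    have e1 : ∑ i, ((ω i : ℤ) : ℝ) * (x i / N) = (∑ i, ((ω i : ℤ) : ℝ) * x i) / N := by
      rw [Finset.sum_div]
      exact Finset.sum_congr rfl fun i _ => by ring
    rw [e1]
    set t := ∑ i, ((ω i : ℤ) : ℝ) * x i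
    have ht : 1 - cos (t / N) ≤ |t / N| := by
      have h1 := Real.one_sub_sq_div_two_le_cos (x := t / N)
      have h2 := Real.neg_one_le_cos (t / N)
      rcases le_total |t / N| 2 with h | h
      · have h3 : (t / N) ^ 2 = |t / N| ^ 2 := (sq_abs _).symm
        nlinarith [abs_nonneg (t / N)]
      · linarith
    rw [abs_div, abs_of_pos hpos, le_div_iff₀ hpos] at ht
    linarith
  refine le_trans ?_ (Finset.sum_le_sum fun ω _ => hterm ω)
  rw [← Finset.mul_sum, Finset.sum_sub_distrib, hcos]
  have hc : (0 : ℝ) ≤ Fintype.card (ι → ℤˣ) := Nat.cast_nonneg _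
  simp only [Finset.sum_const, Finset.card_univ, nsmul_eq_mul, mul_one]
  have : (Fintype.card (ι → ℤˣ) : ℝ) * N * ∏ i, cos (x i / N) ≤
      (Fintype.card (ι → ℤˣ) : ℝ) * N * (5 / 6) := by gcongr
  linarith

section Suprema

variable {T : Type*}

/-- Boundedness of a real function. -/
def IsBdd (u : T → ℝ) : Prop := ∃ M, ∀ t, |u t| ≤ M

theorem IsBdd.bddAbove {u : T → ℝ} (h : IsBdd u) : BddAbove (Set.range u) := by
  obtain ⟨M, hM⟩ := h
  exact ⟨M, by rintro _ ⟨t, rfl⟩; exact (le_abs_self _).trans (hM t)⟩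

theorem IsBdd.le_ciSup {u : T → ℝ} (h : IsBdd u) (t : T) : u t ≤ ⨆ t, u t :=
  _root_.le_ciSup h.bddAbove t

theorem IsBdd.add {u v : T → ℝ} (hu : IsBdd u) (hv : IsBdd v) : IsBdd fun t => u t + v t := by
  obtain ⟨M, hM⟩ := hu
  obtain ⟨N, hN⟩ := hv
  exact ⟨M + N, fun t => (abs_add_le _ _).trans (add_le_add (hM t) (hN t))⟩

theorem IsBdd.mul_left {u : T → ℝ} (c : ℝ) (hu : IsBdd u) : IsBdd fun t => c * u t := by
  obtain ⟨M, hM⟩ := hu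
  exact ⟨|c| * M, fun t => by rw [abs_mul]; exact mul_le_mul_of_nonneg_left (hM t) (abs_nonneg _)⟩

theorem IsBdd.sub {u v : T → ℝ} (hu : IsBdd u) (hv : IsBdd v) : IsBdd fun t => u t - v t := by
  simpa [sub_eq_add_neg] using hu.add (hv.mul_left (-1))

theorem IsBdd.abs {u : T → ℝ} (hu : IsBdd u) : IsBdd fun t => |u t| := by
  obtain ⟨M, hM⟩ := hu
  exact ⟨M, fun t => by rw [abs_abs]; exact hM t⟩

theorem IsBdd.zero : IsBdd fun _ : T => (0 : ℝ) := ⟨0, fun t => by simp⟩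

theorem IsBdd.sum {κ : Type*} (s : Finset κ) {u : κ → T → ℝ} (hu : ∀ i, IsBdd (u i)) :
    IsBdd fun t => ∑ i ∈ s, u i t := by
  induction s using Finset.induction_on with
  | empty => simpa using IsBdd.zero
  | insert a s ha ih => simpa [Finset.sum_insert ha] using (hu a).add ih

theorem IsBdd.expect {κ : Type*} [Fintype κ] {u : κ → T → ℝ} (hu : ∀ i, IsBdd (u i)) :
    IsBdd fun t => 𝔼 i, u i t := by
  simp only [Fintype.expect_eq_sum_div_card, div_eq_inv_mul]
  exact (IsBdd.sum _ hu).mul_left _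

variable [Nonempty T]

theorem ciSup_expect_le {κ : Type*} [Fintype κ] {u : κ → T → ℝ} (hu : ∀ i, IsBdd (u i)) :
    ⨆ t, 𝔼 i, u i t ≤ 𝔼 i, ⨆ t, u i t :=
  ciSup_le fun t => Finset.expect_le_expect fun i _ => (hu i).le_ciSup t

theorem ciSup_add_le' {u v : T → ℝ} (hu : IsBdd u) (hv : IsBdd v) :
    ⨆ t, (u t + v t) ≤ (⨆ t, u t) + ⨆ t, v t :=
  ciSup_le fun t => add_le_add (hu.le_ciSup t) (hv.le_ciSup t)

theorem ciSup_abs_contraction {A u : T → ℝ} (hA : IsBdd A) (hu : IsBdd u) :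
    (⨆ t, (A t + |u t|)) + (⨆ t, (A t - |u t|)) ≤ (⨆ t, (A t + u t)) + ⨆ t, (A t - u t) := by
  rw [← le_sub_iff_add_le]
  refine ciSup_le fun t => ?_
  rw [le_sub_comm]
  refine ciSup_le fun t' => ?_
  have h1 := (hA.add hu).le_ciSup t
  have h2 := (hA.add hu).le_ciSup t'
  have h3 := (hA.sub hu).le_ciSup t
  have h4 := (hA.sub hu).le_ciSup t'
  rcases abs_cases (u t) with h | h <;> rcases abs_cases (u t') with h' | h' <;> linarith

theorem sum_signs_succ {n : ℕ} (F : (Fin (n + 1) → ℤˣ) → ℝ) :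
    ∑ ε, F ε = ∑ ε : Fin n → ℤˣ, (F (Fin.cons 1 ε) + F (Fin.cons (-1) ε)) := by
  rw [← (Fin.consEquiv fun _ : Fin (n + 1) => ℤˣ).sum_comp, Fintype.sum_prod_type,
    Finset.sum_comm]
  refine Finset.sum_congr rfl fun ε _ => ?_
  rw [UnitsInt.univ]
  simp [Fin.consEquiv]

/-- Contraction principle for absolute values of Rademacher sums. -/
theorem sum_signs_contraction {n : ℕ} {A : T → ℝ} (hA : IsBdd A) {u : Fin n → T → ℝ}
    (hu : ∀ i, IsBdd (u i)) :
    ∑ ε : Fin n → ℤˣ, ⨆ t, (A t + ∑ i, ((ε i : ℤ) : ℝ) * |u i t|) ≤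
      ∑ ε : Fin n → ℤˣ, ⨆ t, (A t + ∑ i, ((ε i : ℤ) : ℝ) * u i t) := by
  induction n generalizing A with
  | zero => simp
  | succ n ih =>
    rw [sum_signs_succ, sum_signs_succ]
    simp only [Fin.sum_univ_succ, Fin.cons_zero, Fin.cons_succ, Units.val_one, Units.val_neg,
      Int.cast_one, Int.cast_neg, one_mul, neg_mul, ← add_assoc, ← sub_eq_add_neg]
    have h1 := ih (hA.add (hu 0).abs) (fun i => hu i.succ)
    have h2 := ih (hA.sub (hu 0).abs) (fun i => hu i.succ)
    rw [Finset.sum_add_distrib]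
    refine (add_le_add h1 h2).trans ?_
    rw [← Finset.sum_add_distrib]
    refine Finset.sum_le_sum fun ε _ => ?_
    have h3 := ciSup_abs_contraction
      (hA.add (IsBdd.sum Finset.univ fun i => (hu (Fin.succ i)).mul_left ((ε i : ℤ) : ℝ))) (hu 0)
    simp only [add_right_comm _ _ |u 0 _|, add_right_comm _ _ (u 0 _), add_sub_right_comm] at h3
    exact h3

theorem expect_eval {Ω : Type*} [Fintype Ω] [Group Ω] {n : ℕ} (f : Ω → ℝ) (i : Fin n) :
    𝔼 a : Fin n → Ω, f (a i) = 𝔼 w, f w := by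
  have h : ∀ w : Ω, 𝔼 a : Fin n → Ω, f (a i) = 𝔼 a : Fin n → Ω, f (a i * w) := fun w =>
    (Fintype.expect_equiv (Equiv.mulRight fun _ : Fin n => w) _ _ fun a => by simp).symm
  calc 𝔼 a : Fin n → Ω, f (a i) = 𝔼 _w : Ω, 𝔼 a : Fin n → Ω, f (a i) :=
        (Fintype.expect_const _).symm
    _ = 𝔼 w : Ω, 𝔼 a : Fin n → Ω, f (a i * w) := Finset.expect_congr rfl fun w _ => h w
    _ = 𝔼 a : Fin n → Ω, 𝔼 w : Ω, f (a i * w) := Finset.expect_comm _ _ _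
    _ = 𝔼 _a : Fin n → Ω, 𝔼 w : Ω, f w := Finset.expect_congr rfl fun a _ =>
        Fintype.expect_equiv (Equiv.mulLeft (a i)) _ _ fun w => by simp
    _ = 𝔼 w, f w := Fintype.expect_const _

/-- Exchanging the coordinates of a pair where the sign is negative. -/
def signSwap {n : ℕ} (Ω : Type*) (ε : Fin n → ℤˣ) :
    (Fin n → Ω) × (Fin n → Ω) ≃ (Fin n → Ω) × (Fin n → Ω) where
  toFun a := (fun i => if ε i = 1 then a.1 i else a.2 i, fun i => if ε i = 1 then a.2 i else a.1 i)
  invFun a := (fun i => if ε i = 1 then a.1 i else a.2 i, fun i => if ε i = 1 then a.2 i else a.1 i)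
  left_inv a := by
    ext i <;> by_cases h : ε i = 1 <;> simp [h]
  right_inv a := by
    ext i <;> by_cases h : ε i = 1 <;> simp [h]

/-- One-sided symmetrization. -/
theorem symmetrization {Ω : Type*} [Fintype Ω] [Group Ω] {n : ℕ} {X : Ω → T → ℝ}
    (hX : ∀ w, IsBdd (X w)) :
    𝔼 a : Fin n → Ω, ⨆ t, (n * 𝔼 w, X w t - ∑ i, X (a i) t) ≤
      2 * 𝔼 a : Fin n → Ω, 𝔼 ε : Fin n → ℤˣ, ⨆ t, ∑ i, ((ε i : ℤ) : ℝ) * X (a i) t := by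
  have hS : ∀ (a : Fin n → Ω) (ε : Fin n → ℤˣ),
      IsBdd fun t => ∑ i, ((ε i : ℤ) : ℝ) * X (a i) t :=
    fun a ε => IsBdd.sum _ fun i => (hX (a i)).mul_left _
  have hS1 : ∀ (a : Fin n → Ω), IsBdd fun t => ∑ i, X (a i) t :=
    fun a => IsBdd.sum _ fun i => hX (a i)
  have h1 : ∀ t, n * 𝔼 w, X w t = 𝔼 a : Fin n → Ω, ∑ i, X (a i) t := by
    intro t
    rw [Finset.expect_sum_comm]
    simp only [expect_eval (fun w => X w t)]
    simp
  have h2 : 𝔼 a : Fin n → Ω, ⨆ t, (n * 𝔼 w, X w t - ∑ i, X (a i) t) ≤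
      𝔼 a : Fin n → Ω, 𝔼 b : Fin n → Ω, ⨆ t, (∑ i, X (b i) t - ∑ i, X (a i) t) := by
    refine Finset.expect_le_expect fun a _ => ?_
    refine le_trans (le_of_eq ?_) (ciSup_expect_le fun b => (hS1 b).sub (hS1 a))
    congr 1
    ext t
    rw [h1, Finset.expect_sub_distrib, Fintype.expect_const]
  have h3 : ∀ ε : Fin n → ℤˣ,
      𝔼 a : Fin n → Ω, 𝔼 b : Fin n → Ω, ⨆ t, (∑ i, X (b i) t - ∑ i, X (a i) t) =
      𝔼 a : Fin n → Ω, 𝔼 b : Fin n → Ω, ⨆ t, ∑ i, ((ε i : ℤ) : ℝ) * (X (b i) t - X (a i) t) := by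
    intro ε
    rw [← Finset.expect_product', ← Finset.expect_product']
    refine Fintype.expect_equiv (signSwap Ω ε) _ _ fun a => ?_
    congr 1
    ext t
    rw [← Finset.sum_sub_distrib]
    refine Finset.sum_congr rfl fun i _ => ?_
    rcases Int.units_eq_one_or (ε i) with h | h <;> simp [signSwap, h]
  have h4 : ∀ (ε : Fin n → ℤˣ) (a b : Fin n → Ω),
      ⨆ t, ∑ i, ((ε i : ℤ) : ℝ) * (X (b i) t - X (a i) t) ≤
      (⨆ t, ∑ i, ((ε i : ℤ) : ℝ) * X (b i) t) +
        ⨆ t, ∑ i, (((-ε) i : ℤ) : ℝ) * X (a i) t := by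
    intro ε a b
    refine le_trans (le_of_eq ?_) (ciSup_add_le' (hS b ε) (hS a (-ε)))
    congr 1
    ext t
    rw [← Finset.sum_add_distrib]
    refine Finset.sum_congr rfl fun i _ => ?_
    simp
    ring
  have h5 : 𝔼 a : Fin n → Ω, 𝔼 b : Fin n → Ω, ⨆ t, (∑ i, X (b i) t - ∑ i, X (a i) t) =
      𝔼 ε : Fin n → ℤˣ, 𝔼 a : Fin n → Ω, 𝔼 b : Fin n → Ω,
        ⨆ t, ∑ i, ((ε i : ℤ) : ℝ) * (X (b i) t - X (a i) t) := by
    rw [← Finset.expect_congr rfl fun ε _ => h3 ε, Fintype.expect_const]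
  refine h2.trans (h5.trans_le ?_)
  have h6 : ∀ ε : Fin n → ℤˣ, 𝔼 a : Fin n → Ω, 𝔼 b : Fin n → Ω,
        ⨆ t, ∑ i, ((ε i : ℤ) : ℝ) * (X (b i) t - X (a i) t) ≤
      (𝔼 b : Fin n → Ω, ⨆ t, ∑ i, ((ε i : ℤ) : ℝ) * X (b i) t) +
        𝔼 a : Fin n → Ω, ⨆ t, ∑ i, (((-ε) i : ℤ) : ℝ) * X (a i) t := by
    intro ε
    refine (Finset.expect_le_expect fun a _ => Finset.expect_le_expect fun b _ =>
      h4 ε a b).trans (le_of_eq ?_)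
    simp only [Finset.expect_add_distrib, Fintype.expect_const]
  refine (Finset.expect_le_expect fun ε _ => h6 ε).trans (le_of_eq ?_)
  rw [Finset.expect_add_distrib]
  have h7 : 𝔼 ε : Fin n → ℤˣ, 𝔼 a : Fin n → Ω, ⨆ t, ∑ i, (((-ε) i : ℤ) : ℝ) * X (a i) t =
      𝔼 ε : Fin n → ℤˣ, 𝔼 a : Fin n → Ω, ⨆ t, ∑ i, ((ε i : ℤ) : ℝ) * X (a i) t :=
    Fintype.expect_equiv (Equiv.neg _) _ _ fun ε => by simp
  rw [h7, Finset.expect_comm]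
  ring

end Suprema

section RandomSubspace

variable {ι : Type*} [Fintype ι] [DecidableEq ι]

/-- The random vector `∑ ± e_k`. -/
def signSum {V : Type*} [AddCommGroup V] [Module ℝ V] (e : ι → V) (w : ι → ℤˣ) : V :=
  ∑ k, ((w k : ℤ) : ℝ) • e k

theorem exists_signs_lower_bound {V : Type*} [NormedAddCommGroup V] [NormedSpace ℝ V]
    (e : ι → V) (m : ℕ) :
    ∃ a : Fin m → ι → ℤˣ, ∀ ψ : V →L[ℝ] ℝ, ‖ψ‖ ≤ 1 → (∀ i, ψ (signSum e (a i)) = 0) →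
      m * (1 / 6 * √(∑ k, ψ (e k) ^ 2)) ≤
        2 * 𝔼 b : Fin m → ι → ℤˣ, ‖∑ i, signSum e (b i)‖ := by
  let T := {ψ : V →L[ℝ] ℝ // ‖ψ‖ ≤ 1}
  have : Nonempty T := ⟨⟨0, by simp⟩⟩
  have hval : ∀ (v : V) (ψ : T), |ψ.1 v| ≤ ‖v‖ := fun v ψ => by
    have := ψ.1.le_of_opNorm_le ψ.2 v
    simpa using this
  have hlin : ∀ v : V, IsBdd fun ψ : T => ψ.1 v := fun v => ⟨‖v‖, hval v⟩
  have hX : ∀ w : ι → ℤˣ, IsBdd fun ψ : T => |ψ.1 (signSum e w)| := fun w => (hlin _).abs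
  have hsymm := symmetrization (T := T) (n := m) hX
  have hcontr : ∀ a : Fin m → ι → ℤˣ,
      𝔼 ε : Fin m → ℤˣ, ⨆ ψ : T, ∑ i, ((ε i : ℤ) : ℝ) * |ψ.1 (signSum e (a i))| ≤
      𝔼 ε : Fin m → ℤˣ, ‖∑ i, signSum e (ε i • a i)‖ := by
    intro a
    have h := sum_signs_contraction (T := T) (n := m) IsBdd.zero
      (u := fun i ψ => ψ.1 (signSum e (a i))) fun i => hlin _
    simp only [zero_add] at h
    rw [Fintype.expect_eq_sum_div_card, Fintype.expect_eq_sum_div_card]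
    refine div_le_div_of_nonneg_right (h.trans (Finset.sum_le_sum fun ε _ => ?_))
      (Nat.cast_nonneg _)
    refine ciSup_le fun ψ => ?_
    have h1 : ∑ i, ((ε i : ℤ) : ℝ) * ψ.1 (signSum e (a i)) =
        ψ.1 (∑ i, signSum e (ε i • a i)) := by
      rw [map_sum]
      refine Finset.sum_congr rfl fun i _ => ?_
      rw [← smul_eq_mul, ← map_smul, signSum, signSum, Finset.smul_sum]
      simp [smul_smul]
    rw [h1]
    exact (le_abs_self _).trans (hval _ _)
  have hrot : ∀ ε : Fin m → ℤˣ, 𝔼 a : Fin m → ι → ℤˣ, ‖∑ i, signSum e (ε i • a i)‖ =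
      𝔼 b : Fin m → ι → ℤˣ, ‖∑ i, signSum e (b i)‖ := by
    intro ε
    refine Fintype.expect_equiv
      (Equiv.mulLeft (fun i : Fin m => (fun _ : ι => ε i))) _ _ fun a => ?_
    congr 1
  have hmain : 𝔼 a : Fin m → ι → ℤˣ, ⨆ ψ : T,
      (m * 𝔼 w : ι → ℤˣ, |ψ.1 (signSum e w)| - ∑ i, |ψ.1 (signSum e (a i))|) ≤
      2 * 𝔼 b : Fin m → ι → ℤˣ, ‖∑ i, signSum e (b i)‖ := by
    refine hsymm.trans (mul_le_mul_of_nonneg_left ?_ two_pos.le)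
    refine (Finset.expect_le_expect fun a _ => hcontr a).trans (le_of_eq ?_)
    rw [Finset.expect_comm, Finset.expect_congr rfl fun ε _ => hrot ε, Fintype.expect_const]
  obtain ⟨a, -, ha⟩ := Finset.exists_le_of_expect_le Finset.univ_nonempty hmain
  refine ⟨a, fun ψ hψ h0 => ?_⟩
  have hbd : IsBdd fun ψ : T =>
      (m * 𝔼 w : ι → ℤˣ, |ψ.1 (signSum e w)| - ∑ i, |ψ.1 (signSum e (a i))|) :=
    ((IsBdd.expect hX).mul_left _).sub (IsBdd.sum _ fun i => hX _)
  have h1 := (hbd.le_ciSup ⟨ψ, hψ⟩).trans ha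
  simp only [h0, abs_zero, Finset.sum_const_zero, sub_zero] at h1
  refine le_trans (mul_le_mul_of_nonneg_left ?_ (Nat.cast_nonneg _)) h1
  rw [Fintype.expect_eq_sum_div_card, le_div_iff₀ (by exact_mod_cast Fintype.card_pos), mul_comm]
  refine (khinchine_lower fun k => ψ (e k)).trans (le_of_eq ?_)
  refine Finset.sum_congr rfl fun w _ => ?_
  simp [signSum, map_sum]

theorem exists_submodule_approx {V : Type*} [NormedAddCommGroup V] [NormedSpace ℂ V]
    [NormedSpace ℝ V] [IsScalarTower ℝ ℂ V] (e : ι → V) {m : ℕ} (hm : 1 ≤ m) :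
    ∃ F : Submodule ℂ V, FiniteDimensional ℂ F ∧ Module.finrank ℂ F ≤ m ∧
      ∀ c : ι → ℂ, ∀ η > 0, ∃ z ∈ F, ‖∑ k, c k • e k - z‖ ≤
        24 / m * (𝔼 b : Fin m → ι → ℤˣ, ‖∑ i, signSum e (b i)‖) * √(∑ k, ‖c k‖ ^ 2) + η := by
  obtain ⟨a, ha⟩ := exists_signs_lower_bound e m
  set M := 𝔼 b : Fin m → ι → ℤˣ, ‖∑ i, signSum e (b i)‖
  have hM : 0 ≤ M := Finset.expect_nonneg fun _ _ => norm_nonneg _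
  have hm0 : (0 : ℝ) < m := by exact_mod_cast hm
  let F : Submodule ℂ V := Submodule.span ℂ (Set.range fun i => signSum e (a i))
  have hF : FiniteDimensional ℂ F := FiniteDimensional.span_of_finite ℂ (Set.finite_range _)
  refine ⟨F, hF, (finrank_range_le_card _).trans (by simp), fun c η hη => ?_⟩
  have hdual : ∀ φ : V →L[ℂ] ℂ, ‖φ‖ ≤ 1 → (∀ z ∈ F, φ z = 0) →
      ‖φ (∑ k, c k • e k)‖ ≤ 24 / m * M * √(∑ k, ‖c k‖ ^ 2) := by
    intro φ hφ h0
    have hpart : ∀ ρ : ℂ →L[ℝ] ℝ, ‖ρ‖ ≤ 1 → ∑ k, ρ (φ (e k)) ^ 2 ≤ (12 / m * M) ^ 2 := by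
      intro ρ hρ
      have h1 := ha (ρ.comp (φ.restrictScalars ℝ)) ?_ ?_
      · simp only [ContinuousLinearMap.comp_apply, ContinuousLinearMap.coe_restrictScalars'] at h1
        have h2 : √(∑ k, ρ (φ (e k)) ^ 2) ≤ 12 / m * M := by
          rw [div_mul_eq_mul_div, le_div_iff₀ hm0]
          linarith
        have h3 := pow_le_pow_left₀ (Real.sqrt_nonneg _) h2 2
        rwa [Real.sq_sqrt (Finset.sum_nonneg fun _ _ => sq_nonneg _)] at h3
      · refine (ContinuousLinearMap.opNorm_comp_le _ _).trans ?_
        rw [ContinuousLinearMap.norm_restrictScalars]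
        exact mul_le_one₀ hρ (norm_nonneg _) hφ
      · intro i
        simp only [ContinuousLinearMap.comp_apply, ContinuousLinearMap.coe_restrictScalars']
        rw [h0 _ (Submodule.subset_span ⟨i, rfl⟩), map_zero]
    have hre := hpart Complex.reCLM Complex.reCLM_norm.le
    have him := hpart Complex.imCLM Complex.imCLM_norm.le
    have hsum : ∑ k, ‖φ (e k)‖ ^ 2 ≤ (24 / m * M) ^ 2 := by
      have h1 : ∑ k, ‖φ (e k)‖ ^ 2 =
          ∑ k, Complex.reCLM (φ (e k)) ^ 2 + ∑ k, Complex.imCLM (φ (e k)) ^ 2 := by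
        rw [← Finset.sum_add_distrib]
        refine Finset.sum_congr rfl fun k _ => ?_
        rw [Complex.sq_norm, Complex.normSq_apply]
        simp [sq]
      have h2 : (24 / m * M) ^ 2 = 4 * (12 / m * M) ^ 2 := by ring
      rw [h1, h2]
      nlinarith [sq_nonneg (12 / m * M)]
    have hcs : ‖φ (∑ k, c k • e k)‖ ≤ ∑ k, ‖c k‖ * ‖φ (e k)‖ := by
      rw [map_sum]
      refine (norm_sum_le _ _).trans (le_of_eq ?_)
      simp
    refine hcs.trans ((Real.sum_mul_le_sqrt_mul_sqrt _ _ _).trans ?_)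
    rw [mul_comm]
    refine mul_le_mul_of_nonneg_right ?_ (Real.sqrt_nonneg _)
    exact Real.sqrt_le_iff.2 ⟨by positivity, hsum⟩
  set y := ∑ k, c k • e k
  have : IsClosed (F : Set V) := F.closed_of_finiteDimensional
  obtain ⟨g, hg1, hg2⟩ := exists_dual_vector'' ℂ (F.mkQ y)
  have hq : ‖F.mkQ y‖ ≤ 24 / m * M * √(∑ k, ‖c k‖ ^ 2) := by
    have h1 := hdual (g.comp F.mkQL) ?_ ?_
    · rw [ContinuousLinearMap.comp_apply] at h1
      change ‖g (F.mkQ y)‖ ≤ _ at h1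
      rw [hg2] at h1
      simpa using h1
    · refine ContinuousLinearMap.opNorm_le_bound _ zero_le_one fun v => ?_
      refine (g.le_of_opNorm_le hg1 _).trans ?_
      rw [one_mul, one_mul]
      exact Submodule.Quotient.norm_mk_le F v
    · intro z hz
      have : F.mkQL z = 0 := (Submodule.Quotient.mk_eq_zero F).2 hz
      rw [ContinuousLinearMap.comp_apply, this, map_zero]
  obtain ⟨v, hv1, hv2⟩ := Submodule.Quotient.norm_mk_lt (S := F) (F.mkQ y) hη
  refine ⟨y - v, ?_, ?_⟩
  · exact (Submodule.Quotient.eq F).1 hv1.symm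
  · rw [sub_sub_cancel]
    linarith

/-- The maximum of finitely many subgaussian Rademacher sums. -/
theorem expect_max_signs_le {κ G : Type*} [Fintype κ] [DecidableEq κ] [Fintype G]
    (y : G → κ → ℝ) {v l : ℝ} (hv : 0 < v) (hl : 0 < l) (hy : ∀ g, ∑ k, y g k ^ 2 ≤ v)
    (hG : 2 * (Fintype.card G : ℝ) ≤ exp l) (Z : (κ → ℤˣ) → ℝ)
    (hZ : ∀ ω, ∃ g, Z ω ≤ |∑ k, ((ω k : ℤ) : ℝ) * y g k|) :
    𝔼 ω, Z ω ≤ 3 / 2 * √(v * l) := by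
  set t := √(l / v) with ht
  have ht0 : 0 < t := Real.sqrt_pos.2 (by positivity)
  have htsq : t ^ 2 * v = l := by
    rw [ht, Real.sq_sqrt (by positivity)]
    field_simp
  set L := 3 / 2 * l with hL
  set S : (κ → ℤˣ) → G → ℝ := fun ω g => ∑ k, ((ω k : ℤ) : ℝ) * y g k with hS
  have hpt : ∀ ω, t * Z ω ≤
      L - 1 + exp (-L) * ∑ g, (exp (t * S ω g) + exp (-t * S ω g)) := by
    intro ω
    obtain ⟨g, hg⟩ := hZ ω
    have h1 : t * Z ω ≤ t * |S ω g| := mul_le_mul_of_nonneg_left hg ht0.le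
    have h2 := add_one_le_exp (t * |S ω g| - L)
    have h3 : exp (t * |S ω g| - L) ≤
        exp (-L) * ∑ g, (exp (t * S ω g) + exp (-t * S ω g)) := by
      rw [sub_eq_neg_add, exp_add]
      refine mul_le_mul_of_nonneg_left ?_ (exp_pos _).le
      refine le_trans ?_ (Finset.single_le_sum
        (f := fun g => exp (t * S ω g) + exp (-t * S ω g))
        (fun _ _ => by positivity) (Finset.mem_univ g))
      have := exp_pos (t * S ω g)
      have := exp_pos (-t * S ω g)
      rcases abs_cases (S ω g) with h | h <;> rw [h.1]
      · linarith
      · rw [mul_neg, ← neg_mul]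
        linarith
    linarith
  have hexp : ∀ (s : ℝ), s ^ 2 = t ^ 2 → ∀ g, 𝔼 ω, exp (s * S ω g) ≤ exp (l / 2) := by
    intro s hs g
    have h1 := sum_signs_exp_le fun k => s * y g k
    rw [Fintype.expect_eq_sum_div_card, div_le_iff₀ (by exact_mod_cast Fintype.card_pos), mul_comm]
    have h2 : ∀ ω : κ → ℤˣ, s * S ω g = ∑ k, ((ω k : ℤ) : ℝ) * (s * y g k) := by
      intro ω
      rw [hS, Finset.mul_sum]
      exact Finset.sum_congr rfl fun k _ => by ring
    simp only [h2]
    refine h1.trans (mul_le_mul_of_nonneg_left (exp_le_exp.2 ?_) (Nat.cast_nonneg _))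
    simp only [mul_pow, ← Finset.mul_sum, hs]
    have := mul_le_mul_of_nonneg_left (hy g) (sq_nonneg t)
    linarith
  have hmean : t * 𝔼 ω, Z ω ≤ L := by
    rw [Finset.mul_expect]
    refine (Finset.expect_le_expect fun ω _ => hpt ω).trans ?_
    rw [Finset.expect_add_distrib, Fintype.expect_const, ← Finset.mul_expect,
      Finset.expect_sum_comm]
    have h1 : ∑ g, 𝔼 ω, (exp (t * S ω g) + exp (-t * S ω g)) ≤
        ∑ _g : G, (exp (l / 2) + exp (l / 2)) := by
      refine Finset.sum_le_sum fun g _ => ?_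
      rw [Finset.expect_add_distrib]
      exact add_le_add (hexp t rfl g) (hexp (-t) (by ring) g)
    have h2 : ∑ _g : G, (exp (l / 2) + exp (l / 2)) ≤ exp L := by
      rw [Finset.sum_const, Finset.card_univ, nsmul_eq_mul]
      have : exp L = exp l * exp (l / 2) := by
        rw [← exp_add, hL]
        ring_nf
      rw [this]
      nlinarith [exp_pos (l / 2)]
    have h3 := mul_le_mul_of_nonneg_left (h1.trans h2) (exp_pos (-L)).le
    rw [← exp_add, neg_add_cancel, exp_zero] at h3
    linarith
  have hfin : t * √(v * l) = l := by
    rw [ht, ← Real.sqrt_mul (by positivity)]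
    have : l / v * (v * l) = l ^ 2 := by field_simp
    rw [this, Real.sqrt_sq hl.le]
  refine le_of_mul_le_mul_left ?_ ht0
  rw [mul_left_comm, hfin]
  exact hmean

end RandomSubspace

section TorusFourier

variable {d : ℕ}

/-- The normalized Haar measure on the torus. -/
def torusProb (d : ℕ) : Measure (Torus d) := ENNReal.ofReal (((2 * π) ^ d)⁻¹) • volume

theorem volume_torus_univ (d : ℕ) :
    (volume : Measure (Torus d)) Set.univ = ENNReal.ofReal ((2 * π) ^ d) := by
  rw [volume_pi, Measure.pi_univ]
  simp [AddCircle.measure_univ, ENNReal.ofReal_pow two_pi_pos.le]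

instance (d : ℕ) : IsProbabilityMeasure (torusProb d) := by
  constructor
  rw [torusProb, Measure.smul_apply, volume_torus_univ, smul_eq_mul,
    ← ENNReal.ofReal_mul (by positivity), inv_mul_cancel₀ (by positivity), ENNReal.ofReal_one]

theorem integral_torusProb {E : Type*} [NormedAddCommGroup E] [NormedSpace ℝ E]
    (f : Torus d → E) : ∫ x, f x ∂torusProb d = ((2 * π) ^ d)⁻¹ • ∫ x, f x := by
  rw [torusProb, integral_smul_measure, ENNReal.toReal_ofReal (by positivity)]

theorem norm_trigChar_apply (k : Fin d → ℤ) (x : Torus d) : ‖trigChar k x‖ = 1 := by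
  simp only [trigChar, ContinuousMap.coe_mk, norm_prod, fourier_apply, Circle.norm_coe,
    Finset.prod_const_one]

theorem trigChar_add (k l : Fin d → ℤ) (x : Torus d) :
    trigChar (k + l) x = trigChar k x * trigChar l x := by
  simp [trigChar, Finset.prod_mul_distrib]

theorem conj_trigChar (k : Fin d → ℤ) (x : Torus d) :
    conj (trigChar k x) = trigChar (-k) x := by
  simp [trigChar, map_prod]

theorem integral_fourier_eq (n : ℤ) :
    ∫ x : AddCircle (2 * π), fourier n x = if n = 0 then ((2 * π : ℝ) : ℂ) else 0 := by
  have h := congrFun (fourierCoeff_fourier (T := 2 * π) n) 0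
  rw [fourierCoeff, AddCircle.integral_haarAddCircle] at h
  simp only [neg_zero, fourier_zero, one_smul] at h
  have hpi : (2 * π : ℝ) ≠ 0 := two_pi_pos.ne'
  rw [inv_smul_eq_iff₀ hpi] at h
  rw [h]
  rcases eq_or_ne n 0 with rfl | hn
  · simp
  · simp [hn]

theorem integral_trigChar (k : Fin d → ℤ) :
    ∫ x, trigChar k x ∂torusProb d = if k = 0 then 1 else 0 := by
  rw [integral_torusProb]
  have h : ∫ x : Torus d, trigChar k x = ∏ j, ∫ t : AddCircle (2 * π), fourier (k j) t :=
    integral_fintype_prod_volume_eq_prod fun j (t : AddCircle (2 * π)) => fourier (k j) t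
  rw [h]
  simp only [integral_fourier_eq]
  split_ifs with hk
  · subst hk
    simp [Complex.real_smul]
  · obtain ⟨j, hj⟩ := Function.ne_iff.1 hk
    rw [Finset.prod_eq_zero (Finset.mem_univ j) (if_neg hj), smul_zero]

theorem integral_conj_trigChar_mul (k l : Fin d → ℤ) :
    ∫ x, conj (trigChar k x) * trigChar l x ∂torusProb d = if l = k then 1 else 0 := by
  simp only [conj_trigChar, ← trigChar_add, integral_trigChar]
  congr 1
  rw [neg_add_eq_zero]
  exact propext eq_comm

/-- Normalized Fourier coefficients. -/
def nCoeff (u : Torus d → ℂ) (k : Fin d → ℤ) : ℂ :=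
  ∫ x, conj (trigChar k x) * u x ∂torusProb d

/-- Trigonometric polynomials. -/
def trigPoly (Λ : Finset (Fin d → ℤ)) (c : (Fin d → ℤ) → ℂ) : C(Torus d, ℂ) :=
  ∑ k ∈ Λ, c k • trigChar k

theorem trigPoly_apply (Λ : Finset (Fin d → ℤ)) (c : (Fin d → ℤ) → ℂ) (x : Torus d) :
    trigPoly Λ c x = ∑ k ∈ Λ, c k * trigChar k x := by
  simp [trigPoly]

theorem integrable_of_bdd {u : Torus d → ℂ} (hu : Measurable u) {B : ℝ} (hB : ∀ x, ‖u x‖ ≤ B) :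
    Integrable u (torusProb d) :=
  Integrable.of_bound hu.aestronglyMeasurable B (Filter.Eventually.of_forall hB)

theorem integrable_cont (f : C(Torus d, ℂ)) : Integrable f (torusProb d) :=
  integrable_of_bdd f.continuous.measurable f.norm_coe_le_norm

theorem integrable_trigChar_mul {u : Torus d → ℂ} (hu : Integrable u (torusProb d))
    (k : Fin d → ℤ) : Integrable (fun x => conj (trigChar k x) * u x) (torusProb d) := by
  simp only [conj_trigChar]
  exact hu.bdd_mul (c := 1) (trigChar (-k)).continuous.aestronglyMeasurable
    (Filter.Eventually.of_forall fun x => (norm_trigChar_apply _ x).le)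

theorem nCoeff_add {u v : Torus d → ℂ} (hu : Integrable u (torusProb d))
    (hv : Integrable v (torusProb d)) (k : Fin d → ℤ) :
    nCoeff (fun x => u x + v x) k = nCoeff u k + nCoeff v k := by
  simp only [nCoeff, mul_add]
  exact integral_add (integrable_trigChar_mul hu k) (integrable_trigChar_mul hv k)

theorem nCoeff_trigPoly (Λ : Finset (Fin d → ℤ)) (c : (Fin d → ℤ) → ℂ) (k : Fin d → ℤ) :
    nCoeff (trigPoly Λ c) k = if k ∈ Λ then c k else 0 := by
  have h : ∀ x, conj (trigChar k x) * trigPoly Λ c x =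
      ∑ l ∈ Λ, c l * (conj (trigChar k x) * trigChar l x) := by
    intro x
    rw [trigPoly_apply, Finset.mul_sum]
    exact Finset.sum_congr rfl fun l _ => by ring
  simp only [nCoeff, h]
  rw [integral_finsetSum _ fun l _ =>
    (integrable_trigChar_mul (integrable_cont (trigChar l)) k).const_mul _]
  simp only [integral_const_mul, integral_conj_trigChar_mul]
  simp

theorem norm_nCoeff_le (f : C(Torus d, ℂ)) (k : Fin d → ℤ) : ‖nCoeff f k‖ ≤ ‖f‖ := by
  refine (norm_integral_le_of_norm_le_const (C := ‖f‖)
    (Filter.Eventually.of_forall fun x => ?_)).trans (by simp)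
  rw [norm_mul, RCLike.norm_conj, norm_trigChar_apply, one_mul]
  exact f.norm_coe_le_norm x

theorem integral_norm_mul_norm_le {u v : Torus d → ℂ} (hu : Measurable u) (hv : Measurable v)
    {A B : ℝ} (hA : ∀ x, ‖u x‖ ≤ A) (hB : ∀ x, ‖v x‖ ≤ B) :
    ∫ x, ‖u x‖ * ‖v x‖ ∂torusProb d ≤
      √(∫ x, ‖u x‖ ^ 2 ∂torusProb d) * √(∫ x, ‖v x‖ ^ 2 ∂torusProb d) := by
  have h := integral_mul_norm_le_Lp_mul_Lq (μ := torusProb d) (f := u) (g := v)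
    Real.HolderConjugate.two_two
    (MemLp.of_bound hu.aestronglyMeasurable A (Filter.Eventually.of_forall hA))
    (MemLp.of_bound hv.aestronglyMeasurable B (Filter.Eventually.of_forall hB))
  simpa [Real.sqrt_eq_rpow] using h

theorem integral_conj_trigPoly_mul (Λ : Finset (Fin d → ℤ)) (c : (Fin d → ℤ) → ℂ)
    {u : Torus d → ℂ} (hu : Integrable u (torusProb d)) :
    ∫ x, conj (trigPoly Λ c x) * u x ∂torusProb d = ∑ k ∈ Λ, conj (c k) * nCoeff u k := by
  have h : ∀ x, conj (trigPoly Λ c x) * u x =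
      ∑ k ∈ Λ, conj (c k) * (conj (trigChar k x) * u x) := by
    intro x
    rw [trigPoly_apply, map_sum, Finset.sum_mul]
    exact Finset.sum_congr rfl fun l _ => by rw [map_mul]; ring
  simp only [h]
  rw [integral_finsetSum _ fun l _ => (integrable_trigChar_mul hu l).const_mul _]
  simp only [integral_const_mul, nCoeff]

theorem integral_norm_trigPoly_sq (Λ : Finset (Fin d → ℤ)) (c : (Fin d → ℤ) → ℂ) :
    ∫ x, ‖trigPoly Λ c x‖ ^ 2 ∂torusProb d = ∑ k ∈ Λ, ‖c k‖ ^ 2 := by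
  have h := integral_conj_trigPoly_mul Λ c (integrable_cont (trigPoly Λ c))
  have h1 : ∀ x, conj (trigPoly Λ c x) * trigPoly Λ c x = ((‖trigPoly Λ c x‖ ^ 2 : ℝ) : ℂ) :=
    fun x => by rw [Complex.conj_mul']; push_cast; rfl
  simp only [h1, nCoeff_trigPoly, integral_complex_ofReal] at h
  have h2 : ∑ k ∈ Λ, conj (c k) * (if k ∈ Λ then c k else 0) =
      ((∑ k ∈ Λ, ‖c k‖ ^ 2 : ℝ) : ℂ) := by
    push_cast
    refine Finset.sum_congr rfl fun k hk => ?_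
    rw [if_pos hk, Complex.conj_mul']
  rw [h2] at h
  exact_mod_cast h

theorem bessel (Λ : Finset (Fin d → ℤ)) {u : Torus d → ℂ} (hu : Measurable u) {B : ℝ}
    (hB : ∀ x, ‖u x‖ ≤ B) :
    ∑ k ∈ Λ, ‖nCoeff u k‖ ^ 2 ≤ ∫ x, ‖u x‖ ^ 2 ∂torusProb d := by
  set P := trigPoly Λ (nCoeff u)
  set S := ∑ k ∈ Λ, ‖nCoeff u k‖ ^ 2 with hS
  have hS0 : 0 ≤ S := Finset.sum_nonneg fun _ _ => sq_nonneg _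
  have hI0 : 0 ≤ ∫ x, ‖u x‖ ^ 2 ∂torusProb d := integral_nonneg fun _ => sq_nonneg _
  have h := integral_conj_trigPoly_mul Λ (nCoeff u) (integrable_of_bdd hu hB)
  have h1 : ∑ k ∈ Λ, conj (nCoeff u k) * nCoeff u k = (S : ℂ) := by
    rw [hS]
    push_cast
    exact Finset.sum_congr rfl fun k _ => Complex.conj_mul' _
  have h2 : S ≤ ∫ x, ‖P x‖ * ‖u x‖ ∂torusProb d := by
    have h3 := norm_integral_le_integral_norm (μ := torusProb d)
      fun x => conj (P x) * u x
    rw [h, h1, Complex.norm_real, Real.norm_of_nonneg hS0] at h3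
    simpa using h3
  have h4 := integral_norm_mul_norm_le (d := d) P.continuous.measurable hu
    P.norm_coe_le_norm hB
  rw [integral_norm_trigPoly_sq] at h4
  have h5 : S ≤ √S * √(∫ x, ‖u x‖ ^ 2 ∂torusProb d) := h2.trans h4
  rw [← Real.sqrt_le_sqrt_iff hI0]
  rcases (Real.sqrt_nonneg S).eq_or_lt with h0 | h0
  · rw [← h0]
    exact Real.sqrt_nonneg _
  · nlinarith [Real.mul_self_sqrt hS0]

theorem trigChar_coe (k : Fin d → ℤ) (t : Fin d → ℝ) :
    trigChar k (fun j => ((t j : ℝ) : AddCircle (2 * π))) =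
      Complex.exp (Complex.I * ((∑ j, (k j : ℝ) * t j : ℝ) : ℂ)) := by
  simp only [trigChar, ContinuousMap.coe_mk, fourier_coe_apply, ← Complex.exp_sum]
  congr 1
  push_cast
  rw [Finset.mul_sum]
  refine Finset.sum_congr rfl fun j _ => ?_
  have : (π : ℂ) ≠ 0 := by exact_mod_cast pi_ne_zero
  field_simp

theorem norm_trigChar_sub_le (k : Fin d → ℤ) (s t : Fin d → ℝ) :
    ‖trigChar k (fun j => ((s j : ℝ) : AddCircle (2 * π))) -
      trigChar k (fun j => ((t j : ℝ) : AddCircle (2 * π)))‖ ≤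
      ∑ j, |(k j : ℝ)| * |s j - t j| := by
  rw [trigChar_coe, trigChar_coe]
  set a := ∑ j, (k j : ℝ) * s j with ha
  set b := ∑ j, (k j : ℝ) * t j with hb
  have h1 : Complex.exp (Complex.I * (a : ℂ)) - Complex.exp (Complex.I * (b : ℂ)) =
      Complex.exp (Complex.I * (b : ℂ)) *
        (Complex.exp (Complex.I * ((a - b : ℝ) : ℂ)) - 1) := by
    rw [mul_sub, ← Complex.exp_add, mul_one]
    push_cast
    ring_nf
  rw [h1, norm_mul, Complex.norm_exp_I_mul_ofReal, one_mul]
  refine (Real.norm_exp_I_mul_ofReal_sub_one_le (x := a - b)).trans ?_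
  rw [Real.norm_eq_abs, ha, hb, ← Finset.sum_sub_distrib]
  refine (Finset.abs_sum_le_sum_abs _ _).trans (le_of_eq ?_)
  exact Finset.sum_congr rfl fun j _ => by rw [← mul_sub, abs_mul]

/-- The point of the uniform grid with `N` nodes per direction. -/
def gridPt (N : ℕ) (g : Fin d → Fin N) : Torus d :=
  fun j => ((2 * π * (g j : ℕ) / N : ℝ) : AddCircle (2 * π))

theorem exists_gridPt {N : ℕ} (hN : 0 < N) (x : Torus d) :
    ∃ g : Fin d → Fin N, ∀ k : Fin d → ℤ,
      ‖trigChar k x - trigChar k (gridPt N g)‖ ≤ (∑ j, |(k j : ℝ)|) * (2 * π / N) := by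
  have hN' : (0 : ℝ) < N := by exact_mod_cast hN
  have hx : ∀ j, ∃ t : ℝ, t ∈ Set.Ico (0 : ℝ) (2 * π) ∧ (t : AddCircle (2 * π)) = x j := by
    intro j
    have := AddCircle.coe_image_Ico_eq (2 * π) 0
    have hm : x j ∈ (QuotientAddGroup.mk '' Set.Ico (0 : ℝ) (0 + 2 * π) :
        Set (AddCircle (2 * π))) := by
      rw [this]
      trivial
    obtain ⟨t, ht, htx⟩ := hm
    exact ⟨t, by simpa using ht, htx⟩
  choose t ht htx using hx
  have hlt : ∀ j, ⌊t j * N / (2 * π)⌋₊ < N := by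
    intro j
    rw [Nat.floor_lt (by have := (ht j).1; positivity), div_lt_iff₀ two_pi_pos, mul_comm]
    exact mul_lt_mul_of_pos_left (ht j).2 hN'
  refine ⟨fun j => ⟨⌊t j * N / (2 * π)⌋₊, hlt j⟩, fun k => ?_⟩
  have hxt : x = fun j => ((t j : ℝ) : AddCircle (2 * π)) := funext fun j => (htx j).symm
  rw [hxt]
  refine (norm_trigChar_sub_le k _ _).trans ?_
  rw [Finset.sum_mul]
  refine Finset.sum_le_sum fun j _ => mul_le_mul_of_nonneg_left ?_ (abs_nonneg _)
  have h0 := (ht j).1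
  have h1 := Nat.floor_le (a := t j * N / (2 * π)) (by positivity)
  have h2 := Nat.lt_floor_add_one (t j * N / (2 * π))
  set q := ((⌊t j * N / (2 * π)⌋₊ : ℕ) : ℝ)
  have h3 : t j = 2 * π * (t j * N / (2 * π)) / N := by field_simp
  have h4 : t j - 2 * π * q / N = 2 * π / N * (t j * N / (2 * π) - q) := by field_simp
  change |t j - 2 * π * q / N| ≤ _
  rw [h4, abs_mul, abs_of_pos (by positivity : 0 < 2 * π / N)]
  refine mul_le_of_le_one_right (by positivity) ?_
  rw [abs_le]
  constructor <;> linarith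

/-- The sup norm of a trigonometric polynomial is controlled by its values on a fine grid. -/
theorem exists_grid_norm_le (Λ : Finset (Fin d → ℤ)) {K : ℝ} {N : ℕ} (hN : 0 < N)
    (hΛ : ∀ k ∈ Λ, ∀ j, |(k j : ℝ)| ≤ K) (hfine : 4 * π * (Λ.card * (d * K)) ≤ N)
    (c : (Fin d → ℤ) → ℂ) :
    ∃ g : Fin d → Fin N, ‖trigPoly Λ c‖ ≤ 2 * ‖trigPoly Λ c (gridPt N g)‖ := by
  have hN' : (0 : ℝ) < N := by exact_mod_cast hN
  set f := trigPoly Λ c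
  have hne : Nonempty (Fin d → Fin N) := ⟨fun _ => ⟨0, hN⟩⟩
  obtain ⟨g, hg⟩ := Finite.exists_max fun g : Fin d → Fin N => ‖f (gridPt N g)‖
  refine ⟨g, ?_⟩
  suffices h : ‖f‖ ≤ ‖f (gridPt N g)‖ + ‖f‖ / 2 by linarith
  rw [ContinuousMap.norm_le _ (by positivity)]
  intro x
  obtain ⟨g', hg'⟩ := exists_gridPt hN x
  have h1 : ‖f x - f (gridPt N g')‖ ≤ ‖f‖ / 2 := by
    rw [trigPoly_apply, trigPoly_apply, ← Finset.sum_sub_distrib]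
    have h2 : ∀ k ∈ Λ, ‖c k * trigChar k x - c k * trigChar k (gridPt N g')‖ ≤
        ‖f‖ * (d * K * (2 * π / N)) := by
      intro k hk
      rw [← mul_sub, norm_mul]
      have h3 : ‖c k‖ ≤ ‖f‖ := by
        have := norm_nCoeff_le f k
        rwa [nCoeff_trigPoly, if_pos hk] at this
      refine mul_le_mul h3 ((hg' k).trans ?_) (norm_nonneg _) (norm_nonneg _)
      refine mul_le_mul_of_nonneg_right ?_ (by positivity)
      refine (Finset.sum_le_sum fun j _ => hΛ k hk j).trans (le_of_eq ?_)
      simp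
    refine (norm_sum_le_of_le _ h2).trans ?_
    rw [Finset.sum_const, nsmul_eq_mul]
    have h4 : (Λ.card : ℝ) * (‖f‖ * (d * K * (2 * π / N))) =
        ‖f‖ / 2 * (4 * π * (Λ.card * (d * K)) / N) := by ring
    rw [h4]
    exact mul_le_of_le_one_right (by positivity) (div_le_one_of_le₀ hfine hN'.le)
  have h6 := hg g'
  have h7 := norm_sub_norm_le (f x) (f (gridPt N g'))
  linarith

end TorusFourier

section TrigWidth

variable {d : ℕ}

theorem signSum_trigChar (Λ : Finset (Fin d → ℤ)) {m : ℕ} (b : Fin m → Λ → ℤˣ) :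
    ∑ i, signSum (fun k : Λ => trigChar k.1) (b i) =
      trigPoly Λ fun k => if h : k ∈ Λ then ((∑ i, ((b i ⟨k, h⟩ : ℤ) : ℝ) : ℝ) : ℂ) else 0 := by
  simp only [signSum, trigPoly]
  rw [Finset.sum_comm, ← Finset.sum_coe_sort Λ]
  refine Finset.sum_congr rfl fun k _ => ?_
  rw [dif_pos k.2, ← Finset.sum_smul, Complex.coe_smul]

theorem expect_norm_signSum_trigChar_le (Λ : Finset (Fin d → ℤ)) (hΛ0 : Λ.Nonempty) {m : ℕ}
    (hm : 1 ≤ m) {K l : ℝ} {N : ℕ} (hN : 0 < N)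
    (hΛ : ∀ k ∈ Λ, ∀ j, |(k j : ℝ)| ≤ K) (hfine : 4 * π * (Λ.card * (d * K)) ≤ N) (hl : 0 < l)
    (hNl : 4 * (N : ℝ) ^ d ≤ exp l) :
    𝔼 b : Fin m → Λ → ℤˣ, ‖∑ i, signSum (fun k : Λ => trigChar k.1) (b i)‖ ≤
      6 * √(m * Λ.card * l) := by
  let y : (Fin d → Fin N) × Bool → Fin m × Λ → ℝ := fun g q =>
    if g.2 then (trigChar q.2.1 (gridPt N g.1)).re else (trigChar q.2.1 (gridPt N g.1)).im
  have hmr : (0 : ℝ) < m := by exact_mod_cast hm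
  have hcard : (0 : ℝ) < Λ.card := by exact_mod_cast hΛ0.card_pos
  have hy : ∀ g, ∑ q, y g q ^ 2 ≤ m * Λ.card := by
    intro g
    have h1 : ∀ q, y g q ^ 2 ≤ 1 := by
      intro q
      have h2 := norm_trigChar_apply q.2.1 (gridPt N g.1)
      rw [sq_le_one_iff_abs_le_one]
      simp only [y]
      split_ifs
      · exact (Complex.abs_re_le_norm _).trans h2.le
      · exact (Complex.abs_im_le_norm _).trans h2.le
    refine (Finset.sum_le_sum fun q _ => h1 q).trans (le_of_eq ?_)
    simp
  have hmax := expect_max_signs_le y (mul_pos hmr hcard) hl hy (by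
      simp only [Fintype.card_prod, Fintype.card_fun, Fintype.card_fin, Fintype.card_bool]
      push_cast
      linarith)
    (fun ω => ‖∑ i, signSum (fun k : Λ => trigChar k.1) (fun k => ω (i, k))‖ / 4) ?_
  · have h1 : 𝔼 b : Fin m → Λ → ℤˣ, ‖∑ i, signSum (fun k : Λ => trigChar k.1) (b i)‖ =
        4 * 𝔼 ω : Fin m × Λ → ℤˣ,
          ‖∑ i, signSum (fun k : Λ => trigChar k.1) (fun k => ω (i, k))‖ / 4 := by
      rw [Finset.mul_expect]
      refine Fintype.expect_equiv (Equiv.curry (Fin m) Λ ℤˣ).symm _ _ fun b => ?_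
      rw [mul_div_cancel₀ _ (by norm_num)]
      rfl
    rw [h1]
    linarith
  · intro ω
    rw [signSum_trigChar]
    obtain ⟨g, hg⟩ := exists_grid_norm_le Λ hN hΛ hfine fun k =>
      if h : k ∈ Λ then ((∑ i, ((ω (i, ⟨k, h⟩) : ℤ) : ℝ) : ℝ) : ℂ) else 0
    have hval : trigPoly Λ (fun k =>
        if h : k ∈ Λ then ((∑ i, ((ω (i, ⟨k, h⟩) : ℤ) : ℝ) : ℝ) : ℂ) else 0) (gridPt N g) =
        ∑ q : Fin m × Λ, (((ω q : ℤ) : ℝ) : ℂ) * trigChar q.2.1 (gridPt N g) := by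
      rw [trigPoly_apply, ← Finset.sum_coe_sort Λ, Fintype.sum_prod_type, Finset.sum_comm]
      refine Finset.sum_congr rfl fun k _ => ?_
      rw [dif_pos k.2, Complex.ofReal_sum, Finset.sum_mul]
    rw [hval] at hg
    set w := ∑ q : Fin m × Λ, (((ω q : ℤ) : ℝ) : ℂ) * trigChar q.2.1 (gridPt N g) with hw
    have hre : ∑ q, ((ω q : ℤ) : ℝ) * y (g, true) q = w.re := by
      rw [hw, Complex.re_sum]
      exact Finset.sum_congr rfl fun q _ => by rw [Complex.re_ofReal_mul]; simp [y]
    have him : ∑ q, ((ω q : ℤ) : ℝ) * y (g, false) q = w.im := by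
      rw [hw, Complex.im_sum]
      exact Finset.sum_congr rfl fun q _ => by rw [Complex.im_ofReal_mul]; simp [y]
    have hn := Complex.norm_le_abs_re_add_abs_im w
    rcases le_total |w.im| |w.re| with h | h
    · refine ⟨(g, true), ?_⟩
      rw [hre]
      linarith
    · refine ⟨(g, false), ?_⟩
      rw [him]
      linarith

theorem norm_trigPoly_le (Λ : Finset (Fin d → ℤ)) (c : (Fin d → ℤ) → ℂ) :
    ‖trigPoly Λ c‖ ≤ √Λ.card * √(∑ k ∈ Λ, ‖c k‖ ^ 2) := by
  rw [ContinuousMap.norm_le _ (by positivity)]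
  intro x
  rw [trigPoly_apply]
  refine (norm_sum_le _ _).trans ?_
  have h := Real.sum_mul_le_sqrt_mul_sqrt Λ (fun _ => 1) fun k => ‖c k‖
  simpa [norm_trigChar_apply] using h

/-- Kolmogorov width in the sup norm of `ℓ₂` balls of trigonometric polynomials. -/
theorem exists_submodule_trigPoly_approx (d : ℕ) (hd : 1 ≤ d) : ∃ C : ℝ, 0 < C ∧
    ∀ n : ℕ, 1 ≤ n → ∀ m : ℕ, 1 ≤ m → ∀ Λ : Finset (Fin d → ℤ),
      (∀ k ∈ Λ, ∀ j, |k j| ≤ 2 ^ (n + 2)) →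
      ∃ F : Submodule ℂ C(Torus d, ℂ), FiniteDimensional ℂ F ∧ Module.finrank ℂ F < m ∧
        ∀ c : (Fin d → ℤ) → ℂ, ∀ η > 0, ∃ z ∈ F, ‖trigPoly Λ c - z‖ ≤
          C * √(Λ.card * n / m) * √(∑ k ∈ Λ, ‖c k‖ ^ 2) + η := by
  set D : ℕ := 2 + d * (7 + 6 * d) with hD
  refine ⟨144 * √(2 * D), by positivity, fun n hn m hm Λ hΛ => ?_⟩
  have hnr : (1 : ℝ) ≤ n := by exact_mod_cast hn
  have hD1 : (1 : ℝ) ≤ D := by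
    rw [hD]
    push_cast
    nlinarith [(Nat.cast_nonneg d : (0 : ℝ) ≤ d)]
  rcases Λ.eq_empty_or_nonempty with rfl | hΛ0
  · refine ⟨⊥, inferInstance, by simp; omega, fun c η hη => ⟨0, Submodule.zero_mem _, ?_⟩⟩
    simp [trigPoly, hη.le]
  rcases hm.eq_or_lt with rfl | hm2
  · refine ⟨⊥, inferInstance, by simp, fun c η hη => ⟨0, Submodule.zero_mem _, ?_⟩⟩
    rw [sub_zero]
    refine (norm_trigPoly_le Λ c).trans ?_
    have h1 : √(Λ.card : ℝ) ≤ 144 * √(2 * D) * √(Λ.card * n / (1 : ℕ)) := by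
      have h2 : √(Λ.card : ℝ) ≤ √(Λ.card * n / (1 : ℕ)) := by
        refine Real.sqrt_le_sqrt ?_
        rw [Nat.cast_one, div_one]
        exact le_mul_of_one_le_right (Nat.cast_nonneg _) hnr
      have h3 : 1 ≤ √(2 * D : ℝ) := Real.one_le_sqrt.2 (by linarith)
      have h4 := Real.sqrt_nonneg (Λ.card * n / (1 : ℕ) : ℝ)
      nlinarith
    have := mul_le_mul_of_nonneg_right h1 (Real.sqrt_nonneg (∑ k ∈ Λ, ‖c k‖ ^ 2))
    linarith
  obtain ⟨m, rfl⟩ : ∃ m', m = m' + 1 := ⟨m - 1, by omega⟩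
  have hm1 : 1 ≤ m := by omega
  have hmr : (1 : ℝ) ≤ m := by exact_mod_cast hm1
  obtain ⟨F, hF, hdim, happ⟩ := exists_submodule_approx (fun k : Λ => trigChar k.1) hm1
  refine ⟨F, hF, by omega, fun c η hη => ?_⟩
  obtain ⟨z, hz, hzle⟩ := happ (fun k => c k.1) η hη
  refine ⟨z, hz, ?_⟩
  have e1 : ∑ k : Λ, c k.1 • (trigChar k.1 : C(Torus d, ℂ)) = trigPoly Λ c :=
    Finset.sum_coe_sort Λ fun k => c k • trigChar k
  have e2 : ∑ k : Λ, ‖c k.1‖ ^ 2 = ∑ k ∈ Λ, ‖c k‖ ^ 2 :=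
    Finset.sum_coe_sort Λ fun k => ‖c k‖ ^ 2
  rw [e1, e2] at hzle
  refine hzle.trans ?_
  refine add_le_add (mul_le_mul_of_nonneg_right ?_ (Real.sqrt_nonneg _)) le_rfl
  set N : ℕ := 2 ^ (n * (7 + 6 * d)) with hNdef
  have hΛr : ∀ k ∈ Λ, ∀ j, |(k j : ℝ)| ≤ (2 : ℝ) ^ (n + 2) := by
    intro k hk j
    exact_mod_cast hΛ k hk j
  have hΛcard : (Λ.card : ℝ) ≤ 2 ^ ((n + 4) * d) := by
    have hsub : Λ ⊆ Fintype.piFinset fun _ : Fin d => Finset.Icc (-(2 ^ (n + 2) : ℤ)) (2 ^ (n + 2)) := by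
      intro k hk
      rw [Fintype.mem_piFinset]
      exact fun j => Finset.mem_Icc.2 (abs_le.1 (hΛ k hk j))
    have h1 := Finset.card_le_card hsub
    rw [Fintype.card_piFinset_const, Int.card_Icc] at h1
    have h2 : ((2 ^ (n + 2) : ℤ) + 1 - -(2 ^ (n + 2) : ℤ)).toNat ≤ 2 ^ (n + 4) := by
      rw [Int.toNat_le]
      have : (1 : ℤ) ≤ 2 ^ (n + 2) := one_le_pow₀ (by norm_num)
      push_cast
      rw [pow_add 2 n 4, pow_add 2 n 2] at *
      linarith
    rw [pow_mul]
    exact_mod_cast h1.trans (Nat.pow_le_pow_left h2 d)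
  have hexp := expect_norm_signSum_trigChar_le Λ hΛ0 hm1 (K := 2 ^ (n + 2)) (l := D * n)
    (N := N) (by positivity) hΛr ?_ (by positivity) ?_
  · refine (mul_le_mul_of_nonneg_left hexp (by positivity)).trans ?_
    have h1 : 144 * √(2 * (D : ℝ)) * √(Λ.card * n / ((m + 1 : ℕ) : ℝ)) =
        144 * √(2 * D * (Λ.card * n / ((m + 1 : ℕ) : ℝ))) := by
      rw [mul_assoc, ← Real.sqrt_mul (by positivity)]
    have h2 : 24 / (m : ℝ) * (6 * √(m * Λ.card * (D * n))) =
        144 * √(Λ.card * (D * n) / m) := by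
      have h3 : (m : ℝ) * Λ.card * (D * n) = m ^ 2 * (Λ.card * (D * n) / m) := by field_simp
      rw [h3, Real.sqrt_mul (by positivity), Real.sqrt_sq (by positivity)]
      field_simp
      norm_num
    rw [h1, h2]
    gcongr
    have h3 : 2 * D * (Λ.card * n / ((m + 1 : ℕ) : ℝ)) =
        Λ.card * (D * n) * (2 / ((m + 1 : ℕ) : ℝ)) := by ring
    rw [h3, div_eq_mul_inv]
    gcongr
    rw [inv_eq_one_div, div_le_div_iff₀ (by positivity) (by positivity)]
    push_cast
    linarith
  · have hπ : 4 * π ≤ 2 ^ 4 := by linarith [pi_le_four]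
    have hd2 : (d : ℝ) ≤ 2 ^ d := by exact_mod_cast Nat.lt_two_pow_self.le
    calc 4 * π * (Λ.card * (d * 2 ^ (n + 2)))
        ≤ 2 ^ 4 * (2 ^ ((n + 4) * d) * (2 ^ d * 2 ^ (n + 2))) := by gcongr
      _ = 2 ^ (4 + ((n + 4) * d + (d + (n + 2)))) := by simp only [pow_add]
      _ ≤ 2 ^ (n * (7 + 6 * d)) := by
        refine pow_le_pow_right₀ one_le_two ?_
        nlinarith [Nat.mul_le_mul_right d hn]
      _ = (N : ℝ) := by rw [hNdef]; push_cast; rfl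
  · have h1 : 4 * (N : ℝ) ^ d = 2 ^ (2 + n * (7 + 6 * d) * d) := by
      rw [hNdef, pow_add, pow_mul _ _ d]
      push_cast
      norm_num
    have h2 : (2 : ℝ) ^ (2 + n * (7 + 6 * d) * d) ≤ 2 ^ (D * n) := by
      refine pow_le_pow_right₀ one_le_two ?_
      rw [hD]
      nlinarith
    have h3 : (2 : ℝ) ^ (D * n) ≤ exp 1 ^ (D * n) :=
      pow_le_pow_left₀ two_pos.le (by linarith [exp_one_gt_d9]) _
    rw [← Real.exp_nat_mul, mul_one] at h3
    push_cast at h3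
    rw [h1]
    exact h2.trans h3

end TrigWidth

section Smoothing

variable {d : ℕ}

/-- The Fourier multiplier of the generalized de la Vallée Poussin kernel
`|B|⁻¹ D_A D_B`, where `D_A` and `D_B` are Dirichlet kernels. -/
def dvpWeight (A B : Finset (Fin d → ℤ)) (k : Fin d → ℤ) : ℝ :=
  ((B.filter fun b => k - b ∈ A).card : ℝ) / B.card

theorem dvpWeight_nonneg (A B : Finset (Fin d → ℤ)) (k : Fin d → ℤ) : 0 ≤ dvpWeight A B k := by
  unfold dvpWeight
  positivity

theorem dvpWeight_le_one (A B : Finset (Fin d → ℤ)) (k : Fin d → ℤ) : dvpWeight A B k ≤ 1 :=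
  div_le_one_of_le₀ (by exact_mod_cast Finset.card_filter_le _ _) (Nat.cast_nonneg _)

theorem dvpWeight_eq_one {A B : Finset (Fin d → ℤ)} (hB : B.Nonempty) {k : Fin d → ℤ}
    (h : ∀ b ∈ B, k - b ∈ A) : dvpWeight A B k = 1 := by
  rw [dvpWeight, Finset.filter_true_of_mem h]
  exact div_self (by exact_mod_cast hB.card_pos.ne')

theorem exists_of_dvpWeight_ne_zero {A B : Finset (Fin d → ℤ)} {k : Fin d → ℤ}
    (h : dvpWeight A B k ≠ 0) : ∃ b ∈ B, k - b ∈ A := by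
  by_contra! hc
  exact h (by simp [dvpWeight, Finset.filter_false_of_mem hc])

/-- Convolution with the kernel `|B|⁻¹ D_A D_B`, with frequencies restricted to `Λ`. -/
def dvpSmooth (A B Λ : Finset (Fin d → ℤ)) (u : Torus d → ℂ) : C(Torus d, ℂ) :=
  trigPoly Λ fun k => (dvpWeight A B k : ℂ) * nCoeff u k

theorem dvpSmooth_add (A B Λ : Finset (Fin d → ℤ)) {u v : Torus d → ℂ}
    (hu : Integrable u (torusProb d)) (hv : Integrable v (torusProb d)) :
    dvpSmooth A B Λ (fun x => u x + v x) = dvpSmooth A B Λ u + dvpSmooth A B Λ v := by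
  simp only [dvpSmooth, trigPoly, nCoeff_add hu hv, mul_add, add_smul, Finset.sum_add_distrib]

theorem dvpSmooth_trigPoly {A B Λ S : Finset (Fin d → ℤ)} {c : (Fin d → ℤ) → ℂ}
    (hB : B.Nonempty) (hS : S ⊆ Λ) (h : ∀ k ∈ S, c k ≠ 0 → ∀ b ∈ B, k - b ∈ A) :
    dvpSmooth A B Λ (trigPoly S c) = trigPoly S c := by
  simp only [dvpSmooth, nCoeff_trigPoly]
  rw [trigPoly, trigPoly, ← Finset.sum_subset hS]
  · refine Finset.sum_congr rfl fun k hk => ?_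
    rw [if_pos hk]
    by_cases hc : c k = 0
    · simp [hc]
    · rw [dvpWeight_eq_one hB (h k hk hc), Complex.ofReal_one, one_mul]
  · intro k _ hk
    rw [if_neg hk, mul_zero, zero_smul]

theorem nCoeff_conj_trigChar_mul (u : Torus d → ℂ) (k l : Fin d → ℤ) :
    nCoeff (fun x => conj (trigChar k x) * u x) l = nCoeff u (k + l) := by
  simp only [nCoeff]
  congr 1
  funext x
  rw [trigChar_add, map_mul]
  ring

theorem dvpSmooth_apply {A B Λ : Finset (Fin d → ℤ)} (hΛ : ∀ a ∈ A, ∀ b ∈ B, a + b ∈ Λ)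
    (u : Torus d → ℂ) (x : Torus d) :
    dvpSmooth A B Λ u x =
      (∑ a ∈ A, trigChar a x * ∑ b ∈ B, trigChar b x * nCoeff u (a + b)) / B.card := by
  have h : ∀ b ∈ B, ∑ k ∈ Λ, (if k - b ∈ A then nCoeff u k * trigChar k x else 0) =
      ∑ a ∈ A, trigChar a x * (trigChar b x * nCoeff u (a + b)) := by
    intro b hb
    rw [← Finset.sum_filter]
    symm
    refine Finset.sum_bij' (fun a _ => a + b) (fun k _ => k - b) ?_ ?_ ?_ ?_ ?_
    · intro a ha
      simp [hΛ a ha b hb, ha]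
    · intro k hk
      exact (Finset.mem_filter.1 hk).2
    · simp
    · simp
    · intro a _
      rw [trigChar_add]
      ring
  simp only [Finset.mul_sum]
  rw [Finset.sum_comm, ← Finset.sum_congr rfl h, Finset.sum_comm, Finset.sum_div, dvpSmooth,
    trigPoly_apply]
  refine Finset.sum_congr rfl fun k _ => ?_
  rw [← Finset.sum_filter, Finset.sum_const, dvpWeight, nsmul_eq_mul]
  push_cast
  ring

theorem norm_dvpSmooth_le {A B Λ : Finset (Fin d → ℤ)} (hΛ : ∀ a ∈ A, ∀ b ∈ B, a + b ∈ Λ)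
    {u : Torus d → ℂ} (hu : Measurable u) {θ : ℝ} (hθ : ∀ x, ‖u x‖ ≤ θ) :
    ‖dvpSmooth A B Λ u‖ ≤ θ * (√A.card * √B.card) / B.card := by
  have hθ0 : 0 ≤ θ := (norm_nonneg _).trans (hθ 0)
  rw [ContinuousMap.norm_le _ (by positivity)]
  intro x
  set F := trigPoly A fun a => conj (trigChar a x) with hF
  set G := trigPoly B fun b => conj (trigChar b x) with hG
  have hui := integrable_of_bdd hu hθ
  have hGu : Integrable (fun y => conj (G y) * u y) (torusProb d) := by
    refine integrable_of_bdd (B := ‖G‖ * θ) ?_ fun y => ?_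
    · exact (Complex.continuous_conj.comp G.continuous).measurable.mul hu
    · rw [norm_mul, RCLike.norm_conj]
      exact mul_le_mul (G.norm_coe_le_norm y) (hθ y) (norm_nonneg _) (norm_nonneg _)
  have hconv : ∫ y, conj (F y) * (conj (G y) * u y) ∂torusProb d =
      ∑ a ∈ A, trigChar a x * ∑ b ∈ B, trigChar b x * nCoeff u (a + b) := by
    rw [integral_conj_trigPoly_mul A _ hGu]
    refine Finset.sum_congr rfl fun a _ => ?_
    rw [Complex.conj_conj]
    congr 1
    have h := integral_conj_trigPoly_mul B (fun b => conj (trigChar b x))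
      (integrable_trigChar_mul hui a)
    simp only [Complex.conj_conj, nCoeff_conj_trigChar_mul] at h
    rw [← h, nCoeff]
    congr 1
    funext y
    ring
  rw [dvpSmooth_apply hΛ, ← hconv, norm_div, Complex.norm_natCast]
  refine div_le_div_of_nonneg_right ?_ (Nat.cast_nonneg _)
  have hcs := integral_norm_mul_norm_le F.continuous.measurable G.continuous.measurable
    F.norm_coe_le_norm G.norm_coe_le_norm
  have h1 : ∀ (S : Finset (Fin d → ℤ)),
      ∫ y, ‖trigPoly S (fun a => conj (trigChar a x)) y‖ ^ 2 ∂torusProb d = S.card := by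
    intro S
    rw [integral_norm_trigPoly_sq]
    simp [norm_trigChar_apply]
  rw [h1, h1] at hcs
  calc ‖∫ y, conj (F y) * (conj (G y) * u y) ∂torusProb d‖
      ≤ ∫ y, θ * (‖F y‖ * ‖G y‖) ∂torusProb d := by
        refine norm_integral_le_of_norm_le ?_ (Filter.Eventually.of_forall fun y => ?_)
        · have hc : Continuous fun y => ‖F y‖ * ‖G y‖ :=
            F.continuous.norm.mul G.continuous.norm
          refine Integrable.of_bound (C := θ * (‖F‖ * ‖G‖))
            (hc.const_mul θ).aestronglyMeasurable (Filter.Eventually.of_forall fun y => ?_)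
          rw [Real.norm_of_nonneg (by positivity)]
          gcongr
          · exact F.norm_coe_le_norm y
          · exact G.norm_coe_le_norm y
        · rw [norm_mul, norm_mul, RCLike.norm_conj, RCLike.norm_conj]
          have := mul_le_mul_of_nonneg_left (hθ y) (mul_nonneg (norm_nonneg (F y)) (norm_nonneg (G y)))
          linarith
    _ = θ * ∫ y, ‖F y‖ * ‖G y‖ ∂torusProb d := integral_const_mul _ _
    _ ≤ _ := mul_le_mul_of_nonneg_left hcs hθ0

end Smoothing

section HyperbolicLayer

variable {d : ℕ}

theorem vpMult_eq_one {m : ℕ} (hm : 0 < m) {k : ℤ} (h : |k| ≤ m) : vpMult m k = 1 := by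
  have hm' : (0 : ℝ) < m := by exact_mod_cast hm
  have h' : |(k : ℝ)| ≤ m := by exact_mod_cast h
  have h1 : 1 ≤ (2 * (m : ℝ) - |(k : ℝ)|) / m := by
    rw [le_div_iff₀ hm']
    linarith
  rw [vpMult, max_eq_right (zero_le_one.trans h1), min_eq_left h1]

theorem vpMult_eq_zero {m : ℕ} {k : ℤ} (h : 2 * (m : ℤ) ≤ |k|) : vpMult m k = 0 := by
  have h' : 2 * (m : ℝ) ≤ |(k : ℝ)| := by exact_mod_cast h
  have h1 : (2 * (m : ℝ) - |(k : ℝ)|) / m ≤ 0 :=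
    div_nonpos_of_nonpos_of_nonneg (by linarith) (Nat.cast_nonneg _)
  rw [vpMult, max_eq_left h1, min_eq_right zero_le_one]

theorem abs_le_of_aMult_ne_zero {s : ℕ} {k : ℤ} (h : aMult s k ≠ 0) : |k| ≤ 2 * 2 ^ s := by
  contrapose! h
  cases s with
  | zero => exact vpMult_eq_zero (by push_cast; simpa using h.le)
  | succ s =>
    rw [pow_succ] at h
    have h0 : (0 : ℤ) ≤ 2 ^ s := by positivity
    rw [aMult, vpMult_eq_zero (by push_cast; rw [pow_succ]; linarith),
      vpMult_eq_zero (by push_cast; linarith), sub_zero]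

theorem le_abs_of_aMult_ne_zero {s : ℕ} {k : ℤ} (h : aMult s k ≠ 0) :
    s = 0 ∨ 2 ^ s ≤ 2 * |k| := by
  rw [or_iff_not_imp_left]
  intro hs
  contrapose! h
  obtain ⟨s, rfl⟩ := Nat.exists_eq_succ_of_ne_zero hs
  rw [Nat.succ_eq_add_one, pow_succ] at h
  have h0 : (0 : ℤ) ≤ 2 ^ s := by positivity
  rw [Nat.succ_eq_add_one, aMult,
    vpMult_eq_one (by positivity) (by push_cast; rw [pow_succ]; linarith),
    vpMult_eq_one (by positivity) (by push_cast; linarith), sub_self]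

/-- An enlargement of the spectrum of the block `𝒜_s`. -/
def outerBlock (s : Fin d → ℕ) : Finset (Fin d → ℤ) :=
  Fintype.piFinset fun j => (Finset.Icc (-(3 * 2 ^ s j : ℤ)) (3 * 2 ^ s j)).filter
    fun a => s j = 0 ∨ 3 * 2 ^ s j ≤ 8 * |a|

/-- A small box of frequencies, with sides proportional to those of the block `𝒜_s`. -/
def innerBox (s : Fin d → ℕ) : Finset (Fin d → ℤ) :=
  Fintype.piFinset fun j => Finset.Icc (-(2 ^ s j / 8 : ℤ)) (2 ^ s j / 8)

/-- A box of frequencies containing the spectrum of the block `𝒜_s`. -/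
def outerBox (s : Fin d → ℕ) : Finset (Fin d → ℤ) :=
  Fintype.piFinset fun j => Finset.Icc (-(2 ^ (s j + 2) : ℤ)) (2 ^ (s j + 2))

theorem mem_outerBlock {s : Fin d → ℕ} {a : Fin d → ℤ} : a ∈ outerBlock s ↔
    ∀ j, |a j| ≤ 3 * 2 ^ s j ∧ (s j = 0 ∨ 3 * 2 ^ s j ≤ 8 * |a j|) := by
  simp only [outerBlock, Fintype.mem_piFinset, Finset.mem_filter, Finset.mem_Icc, abs_le]

theorem mem_innerBox {s : Fin d → ℕ} {b : Fin d → ℤ} :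
    b ∈ innerBox s ↔ ∀ j, |b j| ≤ 2 ^ s j / 8 := by
  simp only [innerBox, Fintype.mem_piFinset, Finset.mem_Icc, abs_le]

theorem mem_outerBox {s : Fin d → ℕ} {k : Fin d → ℤ} :
    k ∈ outerBox s ↔ ∀ j, |k j| ≤ 2 ^ (s j + 2) := by
  simp only [outerBox, Fintype.mem_piFinset, Finset.mem_Icc, abs_le]

theorem innerBox_nonempty (s : Fin d → ℕ) : (innerBox s).Nonempty :=
  ⟨0, mem_innerBox.2 fun j => by
    rw [Pi.zero_apply, abs_zero]
    positivity⟩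

theorem sub_mem_outerBlock {s : Fin d → ℕ} {k b : Fin d → ℤ} (hk : ∀ j, aMult (s j) (k j) ≠ 0)
    (hb : b ∈ innerBox s) : k - b ∈ outerBlock s := by
  rw [mem_outerBlock]
  intro j
  have hb := mem_innerBox.1 hb j
  have h0 : (0 : ℤ) < 2 ^ s j := by positivity
  have h1 := abs_le_of_aMult_ne_zero (hk j)
  have h2 := abs_sub (k j) (b j)
  have h3 := abs_sub_abs_le_abs_sub (k j) (b j)
  rw [Pi.sub_apply]
  refine ⟨by omega, ?_⟩
  rcases le_abs_of_aMult_ne_zero (hk j) with h | h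
  · exact Or.inl h
  · right
    omega

theorem abs_add_le_of_mem {s : Fin d → ℕ} {a b : Fin d → ℤ} (ha : a ∈ outerBlock s)
    (hb : b ∈ innerBox s) (j : Fin d) :
    |(a + b) j| ≤ 4 * 2 ^ s j ∧ (s j = 0 ∨ 2 ^ s j ≤ 4 * |(a + b) j|) := by
  obtain ⟨h1, h2⟩ := mem_outerBlock.1 ha j
  have hb := mem_innerBox.1 hb j
  have h0 : (0 : ℤ) < 2 ^ s j := by positivity
  have h3 := abs_add_le (a j) (b j)
  have h4 := abs_sub_abs_le_abs_sub (a j) (-b j)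
  rw [abs_neg, sub_neg_eq_add] at h4
  rw [Pi.add_apply]
  exact ⟨by omega, h2.imp id fun h => by omega⟩

theorem add_mem_outerBox {s : Fin d → ℕ} {a b : Fin d → ℤ} (ha : a ∈ outerBlock s)
    (hb : b ∈ innerBox s) : a + b ∈ outerBox s :=
  mem_outerBox.2 fun j => by
    rw [pow_add, mul_comm]
    exact (abs_add_le_of_mem ha hb j).1

theorem Abox_subset_outerBox (s : Fin d → ℕ) : Abox d s ⊆ outerBox s := by
  intro k hk
  rw [Abox, Finset.mem_Icc, Pi.le_def, Pi.le_def] at hk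
  refine mem_outerBox.2 fun j => ?_
  refine (abs_le.2 ⟨hk.1 j, hk.2 j⟩).trans ?_
  exact pow_le_pow_right₀ one_le_two (by omega)

theorem card_outerBlock_le (s : Fin d → ℕ) :
    ((outerBlock s).card : ℝ) ≤ 56 ^ d * (innerBox s).card := by
  rw [outerBlock, innerBox, Fintype.card_piFinset, Fintype.card_piFinset]
  have h : ∀ j, ((Finset.Icc (-(3 * 2 ^ s j : ℤ)) (3 * 2 ^ s j)).filter
      fun a => s j = 0 ∨ 3 * 2 ^ s j ≤ 8 * |a|).card ≤
      56 * (Finset.Icc (-(2 ^ s j / 8 : ℤ)) (2 ^ s j / 8)).card := by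
    intro j
    refine (Finset.card_filter_le _ _).trans ?_
    rw [Int.card_Icc, Int.card_Icc]
    have h0 : (0 : ℤ) < 2 ^ s j := by positivity
    omega
  have h2 := Finset.prod_le_prod' (s := Finset.univ) fun j _ => h j
  rw [Finset.prod_mul_distrib, Finset.prod_const, Finset.card_univ, Fintype.card_fin] at h2
  exact_mod_cast h2

theorem card_outerBox_le (s : Fin d → ℕ) : (outerBox s).card ≤ 9 ^ d * 2 ^ ∑ j, s j := by
  rw [outerBox, Fintype.card_piFinset]
  have h : ∀ j, (Finset.Icc (-(2 ^ (s j + 2) : ℤ)) (2 ^ (s j + 2))).card ≤ 9 * 2 ^ s j := by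
    intro j
    rw [Int.card_Icc, Int.toNat_le, pow_add]
    push_cast
    have h0 : (1 : ℤ) ≤ 2 ^ s j := one_le_pow₀ one_le_two
    linarith
  have h2 := Finset.prod_le_prod' (s := Finset.univ) fun j _ => h j
  rwa [Finset.prod_mul_distrib, Finset.prod_const, Finset.card_univ, Fintype.card_fin,
    Finset.prod_pow_eq_pow_sum] at h2

theorem mem_Icc_log {s : ℕ} {k : ℤ} (h1 : |k| ≤ 4 * 2 ^ s) (h2 : s = 0 ∨ 2 ^ s ≤ 4 * |k|) :
    s ∈ Finset.Icc (Nat.log 2 k.natAbs - 2) (Nat.log 2 k.natAbs + 2) := by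
  have e : |k| = (k.natAbs : ℤ) := (Int.natCast_natAbs k).symm
  rw [e] at h1 h2
  generalize k.natAbs = q at *
  have h1 : q ≤ 2 ^ (s + 2) := by
    rw [pow_add]
    have : (q : ℤ) ≤ ((4 * 2 ^ s : ℕ) : ℤ) := by exact_mod_cast h1
    omega
  rw [Finset.mem_Icc]
  constructor
  · have h3 := Nat.log_mono_right (b := 2) h1
    rw [Nat.log_pow one_lt_two] at h3
    omega
  · rcases h2 with h2 | h2
    · omega
    have h2 : 2 ^ s ≤ 4 * q := by exact_mod_cast h2
    have h3 := Nat.lt_pow_succ_log_self one_lt_two q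
    have h4 : 2 ^ s < 2 ^ (Nat.log 2 q + 3) := by
      rw [pow_succ] at h3
      rw [pow_add]
      omega
    have := (Nat.pow_lt_pow_iff_right one_lt_two).1 h4
    omega

theorem card_filter_dvpWeight_le (I : Finset (Fin d → ℕ)) (k : Fin d → ℤ) :
    (I.filter fun s => dvpWeight (outerBlock s) (innerBox s) k ≠ 0).card ≤ 5 ^ d := by
  have hsub : (I.filter fun s => dvpWeight (outerBlock s) (innerBox s) k ≠ 0) ⊆
      Fintype.piFinset fun j =>
        Finset.Icc (Nat.log 2 (k j).natAbs - 2) (Nat.log 2 (k j).natAbs + 2) := by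
    intro s hs
    obtain ⟨b, hb, ha⟩ := exists_of_dvpWeight_ne_zero (Finset.mem_filter.1 hs).2
    rw [Fintype.mem_piFinset]
    intro j
    have h := abs_add_le_of_mem ha hb j
    rw [sub_add_cancel] at h
    exact mem_Icc_log h.1 h.2
  refine (Finset.card_le_card hsub).trans ?_
  rw [Fintype.card_piFinset]
  refine (Finset.prod_le_pow_card _ _ 5 fun j _ => ?_).trans (by simp)
  rw [Nat.card_Icc]
  omega

/-- The multi-indices `s` with `‖s‖₁ = n`. -/
def hypLayer (d n : ℕ) : Finset (Fin d → ℕ) :=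
  (Finset.Icc (0 : Fin d → ℕ) fun _ => n).filter fun s => ∑ j, s j = n

theorem sum_eq_of_mem_hypLayer {n : ℕ} {s : Fin d → ℕ} (hs : s ∈ hypLayer d n) :
    ∑ j, s j = n := (Finset.mem_filter.1 hs).2

theorem card_hypLayer_le (d : ℕ) (hd : 1 ≤ d) (n : ℕ) :
    (hypLayer d n).card ≤ (n + 1) ^ (d - 1) := by
  obtain ⟨e, rfl⟩ : ∃ e, d = e + 1 := ⟨d - 1, by omega⟩
  have h : (hypLayer (e + 1) n).card ≤
      (Fintype.piFinset fun _ : Fin e => Finset.range (n + 1)).card := by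
    refine Finset.card_le_card_of_injOn Fin.tail ?_ ?_
    · intro s hs
      rw [Finset.mem_coe, Fintype.mem_piFinset]
      intro j
      rw [Finset.mem_range, Nat.lt_succ_iff, ← sum_eq_of_mem_hypLayer hs]
      exact Finset.single_le_sum (fun i _ => Nat.zero_le (s i)) (Finset.mem_univ j.succ)
    · intro s hs t ht hst
      have h1 := sum_eq_of_mem_hypLayer hs
      have h2 := sum_eq_of_mem_hypLayer ht
      rw [Fin.sum_univ_succ] at h1 h2
      have h3 : ∀ j : Fin e, s j.succ = t j.succ := fun j => congrFun hst j
      simp only [h3] at h1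
      funext j
      refine Fin.cases ?_ h3 j
      omega
  simpa using h

/-- The frequencies of polynomials in the hyperbolic layer. -/
def layerFreq (d n : ℕ) : Finset (Fin d → ℤ) := (hypLayer d n).biUnion outerBox

theorem card_layerFreq_le (d n : ℕ) :
    (layerFreq d n).card ≤ (hypLayer d n).card * (9 ^ d * 2 ^ n) := by
  refine Finset.card_biUnion_le_card_mul _ _ _ fun s hs => ?_
  rw [← sum_eq_of_mem_hypLayer hs]
  exact card_outerBox_le s

theorem abs_le_of_mem_layerFreq {n : ℕ} {k : Fin d → ℤ} (hk : k ∈ layerFreq d n) (j : Fin d) :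
    |k j| ≤ 2 ^ (n + 2) := by
  obtain ⟨s, hs, hk⟩ := Finset.mem_biUnion.1 hk
  refine (mem_outerBox.1 hk j).trans (pow_le_pow_right₀ one_le_two ?_)
  have := Finset.single_le_sum (fun i _ => Nat.zero_le (s i)) (Finset.mem_univ j)
  rw [sum_eq_of_mem_hypLayer hs] at this
  omega

end HyperbolicLayer

section Truncation

variable {d : ℕ}

/-- The large values of a function. -/
def largePart (θ : ℝ) (u : Torus d → ℂ) (x : Torus d) : ℂ := if θ < ‖u x‖ then u x else 0

/-- The small values of a function. -/
def smallPart (θ : ℝ) (u : Torus d → ℂ) (x : Torus d) : ℂ := if θ < ‖u x‖ then 0 else u x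

theorem smallPart_add_largePart (θ : ℝ) (u : Torus d → ℂ) :
    (fun x => smallPart θ u x + largePart θ u x) = u := by
  funext x
  unfold smallPart largePart
  split_ifs <;> simp

theorem measurable_largePart (θ : ℝ) {u : Torus d → ℂ} (hu : Measurable u) :
    Measurable (largePart θ u) :=
  Measurable.ite (measurableSet_lt measurable_const hu.norm) hu measurable_const

theorem measurable_smallPart (θ : ℝ) {u : Torus d → ℂ} (hu : Measurable u) :
    Measurable (smallPart θ u) :=
  Measurable.ite (measurableSet_lt measurable_const hu.norm) measurable_const hu

theorem norm_smallPart_le {θ : ℝ} (hθ : 0 ≤ θ) (u : Torus d → ℂ) (x : Torus d) :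
    ‖smallPart θ u x‖ ≤ θ := by
  unfold smallPart
  split_ifs with h
  · simpa using hθ
  · exact not_lt.1 h

theorem norm_largePart_le (θ : ℝ) (f : C(Torus d, ℂ)) (x : Torus d) :
    ‖largePart θ f x‖ ≤ ‖f‖ := by
  unfold largePart
  split_ifs with h
  · exact f.norm_coe_le_norm x
  · simp

theorem integrable_norm_rpow (f : C(Torus d, ℂ)) {p : ℝ} (hp : 0 ≤ p) :
    Integrable (fun x => ‖f x‖ ^ p) (torusProb d) := by
  refine Integrable.of_bound (C := ‖f‖ ^ p)
    (f.continuous.norm.rpow_const fun _ => Or.inr hp).aestronglyMeasurable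
    (Filter.Eventually.of_forall fun x => ?_)
  rw [Real.norm_of_nonneg (by positivity)]
  exact Real.rpow_le_rpow (norm_nonneg _) (f.norm_coe_le_norm x) hp

theorem integral_norm_largePart_sq_le (f : C(Torus d, ℂ)) {θ p : ℝ} (hθ : 0 < θ) (hp : 2 ≤ p) :
    ∫ x, ‖largePart θ f x‖ ^ 2 ∂torusProb d ≤ θ ^ (2 - p) * ∫ x, ‖f x‖ ^ p ∂torusProb d := by
  rw [← integral_const_mul]
  refine integral_mono ?_ ((integrable_norm_rpow f (by linarith)).const_mul _) fun x => ?_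
  · refine Integrable.of_bound (C := ‖f‖ ^ 2)
      ((measurable_largePart θ f.continuous.measurable).norm.pow_const 2).aestronglyMeasurable
      (Filter.Eventually.of_forall fun x => ?_)
    rw [Real.norm_of_nonneg (by positivity)]
    exact pow_le_pow_left₀ (norm_nonneg _) (norm_largePart_le θ f x) 2
  · dsimp only
    unfold largePart
    split_ifs with h
    · have h0 := hθ.trans h
      calc ‖f x‖ ^ 2 = ‖f x‖ ^ (2 - p) * ‖f x‖ ^ p := by
            rw [← Real.rpow_add h0, sub_add_cancel, Real.rpow_two]
        _ ≤ θ ^ (2 - p) * ‖f x‖ ^ p := by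
            refine mul_le_mul_of_nonneg_right ?_ (by positivity)
            exact Real.rpow_le_rpow_of_nonpos hθ h.le (by linarith)
    · rw [norm_zero, zero_pow two_ne_zero]
      positivity

theorem norm_sum_sq_le {ι : Type*} (s : Finset ι) (a : ι → ℂ) {N : ℕ}
    (hN : (s.filter fun i => a i ≠ 0).card ≤ N) :
    ‖∑ i ∈ s, a i‖ ^ 2 ≤ N * ∑ i ∈ s, ‖a i‖ ^ 2 := by
  rw [← Finset.sum_filter_ne_zero]
  calc ‖∑ i ∈ s with a i ≠ 0, a i‖ ^ 2 ≤ (∑ i ∈ s with a i ≠ 0, ‖a i‖) ^ 2 :=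
        pow_le_pow_left₀ (norm_nonneg _) (norm_sum_le _ _) 2
    _ ≤ (s.filter fun i => a i ≠ 0).card * ∑ i ∈ s with a i ≠ 0, ‖a i‖ ^ 2 :=
        sq_sum_le_card_mul_sum_sq
    _ ≤ N * ∑ i ∈ s, ‖a i‖ ^ 2 := by
        refine mul_le_mul (by exact_mod_cast hN) ?_ (by positivity) (by positivity)
        exact Finset.sum_le_sum_of_subset_of_nonneg (Finset.filter_subset _ _)
          fun _ _ _ => by positivity

theorem sqrt_card_outerBlock_mul_le (s : Fin d → ℕ) :
    √(outerBlock s).card * √(innerBox s).card / (innerBox s).card ≤ 56 ^ d := by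
  have hB : (0 : ℝ) < (innerBox s).card := by exact_mod_cast (innerBox_nonempty s).card_pos
  rw [div_le_iff₀ hB, ← Real.sqrt_mul (Nat.cast_nonneg _)]
  refine Real.sqrt_le_iff.2 ⟨by positivity, ?_⟩
  have h1 : (1 : ℝ) ≤ 56 ^ d := one_le_pow₀ (by norm_num)
  calc ((outerBlock s).card : ℝ) * (innerBox s).card
      ≤ 56 ^ d * (innerBox s).card * (innerBox s).card := by
        gcongr
        exact card_outerBlock_le s
    _ ≤ 56 ^ d * (56 ^ d * (innerBox s).card * (innerBox s).card) :=
        le_mul_of_one_le_left (by positivity) h1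
    _ = _ := by ring

/-- A sum of blocks with small `L_p` norms is the sum of a uniformly small function and of a
trigonometric polynomial with small `ℓ₂` norm of the coefficients. -/
theorem exists_trigPoly_norm_sub_le {n : ℕ} {θ p E : ℝ} (hθ : 0 < θ) (hp : 2 ≤ p)
    (c : (Fin d → ℕ) → (Fin d → ℤ) → ℂ)
    (hc : ∀ s k, c s k ≠ 0 → ∀ j, aMult (s j) (k j) ≠ 0)
    (hE : ∀ s ∈ hypLayer d n, ∫ x, ‖trigPoly (Abox d s) (c s) x‖ ^ p ∂torusProb d ≤ E) :
    ∃ b : (Fin d → ℤ) → ℂ,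
      ‖∑ s ∈ hypLayer d n, trigPoly (Abox d s) (c s) - trigPoly (layerFreq d n) b‖ ≤
        (hypLayer d n).card * (56 ^ d * θ) ∧
      ∑ k ∈ layerFreq d n, ‖b k‖ ^ 2 ≤
        5 ^ d * ((hypLayer d n).card * (θ ^ (2 - p) * E)) := by
  set P := fun s => trigPoly (Abox d s) (c s)
  set w := fun s : Fin d → ℕ => dvpWeight (outerBlock s) (innerBox s)
  set T := fun s : Fin d → ℕ => dvpSmooth (outerBlock s) (innerBox s) (layerFreq d n)
  have hsub : ∀ s ∈ hypLayer d n, outerBox s ⊆ layerFreq d n := fun s hs =>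
    Finset.subset_biUnion_of_mem outerBox hs
  have hPm : ∀ s, Measurable (P s) := fun s => (P s).continuous.measurable
  have hTP : ∀ s ∈ hypLayer d n, P s = T s (smallPart θ (P s)) + T s (largePart θ (P s)) := by
    intro s hs
    rw [← dvpSmooth_add, smallPart_add_largePart]
    · refine (dvpSmooth_trigPoly (innerBox_nonempty s)
        ((Abox_subset_outerBox s).trans (hsub s hs)) fun k _ hk b hb => ?_).symm
      exact sub_mem_outerBlock (hc s k hk) hb
    · exact integrable_of_bdd (measurable_smallPart θ (hPm s)) (norm_smallPart_le hθ.le _)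
    · exact integrable_of_bdd (measurable_largePart θ (hPm s)) (norm_largePart_le θ _)
  refine ⟨fun k => ∑ s ∈ hypLayer d n, (w s k : ℂ) * nCoeff (largePart θ (P s)) k, ?_, ?_⟩
  · have h1 : trigPoly (layerFreq d n)
        (fun k => ∑ s ∈ hypLayer d n, (w s k : ℂ) * nCoeff (largePart θ (P s)) k) =
        ∑ s ∈ hypLayer d n, T s (largePart θ (P s)) := by
      simp only [T, dvpSmooth, trigPoly, Finset.sum_smul]
      exact Finset.sum_comm
    rw [h1, ← Finset.sum_sub_distrib, ← nsmul_eq_mul]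
    refine (norm_sum_le _ _).trans (Finset.sum_le_card_nsmul _ _ _ fun s hs => ?_)
    have h2 : trigPoly (Abox d s) (c s) - T s (largePart θ (P s)) = T s (smallPart θ (P s)) :=
      sub_eq_of_eq_add (hTP s hs)
    rw [h2]
    refine (norm_dvpSmooth_le (fun a ha b hb => hsub s hs (add_mem_outerBox ha hb))
      (measurable_smallPart θ (hPm s)) (norm_smallPart_le hθ.le _)).trans ?_
    rw [mul_div_assoc, mul_comm]
    exact mul_le_mul_of_nonneg_right (sqrt_card_outerBlock_mul_le s) hθ.le
  · have h1 : ∀ k, ‖∑ s ∈ hypLayer d n, (w s k : ℂ) * nCoeff (largePart θ (P s)) k‖ ^ 2 ≤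
        5 ^ d * ∑ s ∈ hypLayer d n, ‖nCoeff (largePart θ (P s)) k‖ ^ 2 := by
      intro k
      have hN : ((hypLayer d n).filter
          fun s => (w s k : ℂ) * nCoeff (largePart θ (P s)) k ≠ 0).card ≤ 5 ^ d := by
        refine (Finset.card_le_card fun s hs => ?_).trans
          (card_filter_dvpWeight_le (hypLayer d n) k)
        rw [Finset.mem_filter] at hs ⊢
        exact ⟨hs.1, fun h0 => hs.2 (by simp only [w, h0, Complex.ofReal_zero, zero_mul])⟩
      refine (norm_sum_sq_le _ _ hN).trans ?_
      push_cast
      refine mul_le_mul_of_nonneg_left (Finset.sum_le_sum fun s _ => ?_) (by positivity)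
      rw [norm_mul, Complex.norm_real, Real.norm_of_nonneg (dvpWeight_nonneg _ _ _)]
      exact pow_le_pow_left₀ (mul_nonneg (dvpWeight_nonneg _ _ _) (norm_nonneg _))
        (mul_le_of_le_one_left (norm_nonneg _) (dvpWeight_le_one _ _ _)) 2
    refine (Finset.sum_le_sum fun k _ => h1 k).trans ?_
    rw [← Finset.mul_sum, Finset.sum_comm, ← nsmul_eq_mul (hypLayer d n).card]
    refine mul_le_mul_of_nonneg_left (Finset.sum_le_card_nsmul _ _ _ fun s hs => ?_)
      (by positivity)
    refine (bessel _ (measurable_largePart θ (hPm s)) (norm_largePart_le θ _)).trans ?_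
    refine (integral_norm_largePart_sq_le _ hθ hp).trans ?_
    exact mul_le_mul_of_nonneg_left (hE s hs) (by positivity)

end Truncation

section KolmogorovNumbers

variable {d : ℕ}

theorem dK_le_of_forall_exists {A B : Type*} [Norm A] [NormedAddCommGroup B] [NormedSpace ℂ B]
    {T : A → B} {m : ℕ} {R : ℝ} (hR : 0 ≤ R) (L : Submodule ℂ B) (hL : FiniteDimensional ℂ L)
    (hm : Module.finrank ℂ L < m)
    (h : ∀ a, ‖a‖ ≤ 1 → ∀ η > 0, ∃ b ∈ L, ‖T a - b‖ ≤ R + η) : dK T m ≤ R := by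
  have hbdd : BddBelow (Set.range fun L : {L : Submodule ℂ B //
      FiniteDimensional ℂ L ∧ Module.finrank ℂ L < m} =>
      ⨆ a : {a : A // ‖a‖ ≤ 1}, ⨅ b : L.1, ‖T a.1 - (b : B)‖) := by
    refine ⟨0, ?_⟩
    rintro _ ⟨L, rfl⟩
    exact Real.iSup_nonneg fun a => Real.iInf_nonneg fun b => norm_nonneg _
  refine (ciInf_le hbdd ⟨L, hL, hm⟩).trans (Real.iSup_le (fun a => ?_) hR)
  refine le_of_forall_pos_le_add fun η hη => ?_
  obtain ⟨b, hb, hle⟩ := h a.1 a.2 η hη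
  refine (ciInf_le ⟨0, ?_⟩ (⟨b, hb⟩ : L)).trans hle
  rintro _ ⟨b, rfl⟩
  exact norm_nonneg _

theorem norm_toLinfty_le (g : C(Torus d, ℂ)) : ‖toLinfty g‖ ≤ ‖g‖ := by
  have h := (ContinuousMap.toLp ∞ (volume : Measure (Torus d)) ℂ (E := ℂ)).le_of_opNorm_le
    (ContinuousMap.toLp_norm_le (μ := (volume : Measure (Torus d))) (p := ∞)) g
  simpa [toLinfty] using h

theorem integral_norm_rpow_torusProb_le (g : C(Torus d, ℂ)) {p σ : ℝ} (hp : 1 ≤ p)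
    (h : (eLpNorm g (ENNReal.ofReal p) volume).toReal ≤ σ) :
    ∫ x, ‖g x‖ ^ p ∂torusProb d ≤ σ ^ p := by
  have hp0 : 0 < p := by linarith
  have hmem : MemLp g (ENNReal.ofReal p) (volume : Measure (Torus d)) :=
    MemLp.of_bound g.continuous.aestronglyMeasurable ‖g‖
      (Filter.Eventually.of_forall g.norm_coe_le_norm)
  have hI0 : 0 ≤ ∫ x, ‖g x‖ ^ p := integral_nonneg fun x => by positivity
  rw [hmem.eLpNorm_eq_integral_rpow_norm (by simpa using hp0) ENNReal.ofReal_ne_top,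
    ENNReal.toReal_ofReal hp0.le, ENNReal.toReal_ofReal (by positivity)] at h
  rw [integral_torusProb, smul_eq_mul]
  have h1 : ∫ x, ‖g x‖ ^ p ≤ σ ^ p := by
    have h2 := Real.rpow_le_rpow (by positivity) h hp0.le
    rwa [← Real.rpow_mul hI0, inv_mul_cancel₀ hp0.ne', Real.rpow_one] at h2
  refine (mul_le_of_le_one_left hI0 (inv_le_one_of_one_le₀ (one_le_pow₀ ?_))).trans h1
  linarith [pi_gt_three]

theorem integral_norm_Asf_rpow_le {p r : ℝ} (hp : 1 ≤ p)
    (f : HNikSpace d r (ENNReal.ofReal p)) (hf : ‖f‖ ≤ 1) {n : ℕ} {s : Fin d → ℕ}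
    (hs : ∑ j, s j = n) :
    ∫ x, ‖Asf s (f.1 : Torus d → ℂ) x‖ ^ p ∂torusProb d ≤ ((2 : ℝ) ^ (-(r * n))) ^ p := by
  have h : hTerm d r (ENNReal.ofReal p) (f.1 : Torus d → ℂ) s ≤ 1 := (le_ciSup f.2 s).trans hf
  refine integral_norm_rpow_torusProb_le _ hp ?_
  have hs' : ∑ j, (s j : ℝ) = n := by exact_mod_cast hs
  rw [hTerm, hs'] at h
  rwa [Real.rpow_neg zero_le_two, ← one_div, le_div_iff₀' (by positivity)]

theorem aMult_ne_zero_of_aMultd_mul_ne_zero {s : Fin d → ℕ} {k : Fin d → ℤ} {z : ℂ}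
    (h : (aMultd s k : ℂ) * z ≠ 0) (j : Fin d) : aMult (s j) (k j) ≠ 0 := by
  have h1 := left_ne_zero_of_mul h
  rw [Complex.ofReal_ne_zero, aMultd, Finset.prod_ne_zero_iff] at h1
  exact h1 j (Finset.mem_univ j)

theorem sqrt_mul_sqrt_layer_le {d n m : ℕ} (hm : 1 ≤ m) (hn : 1 ≤ n) {p σ S : ℝ} (hp : 2 ≤ p)
    (hσ : 0 < σ)
    (hS : S ≤ 5 ^ d * ((hypLayer d n).card *
      ((σ * (2 ^ n / m * n) ^ (1 / p)) ^ (2 - p) * σ ^ p))) :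
    √((layerFreq d n).card * n / m) * √S ≤
      45 ^ d * ((hypLayer d n).card : ℝ) * (σ * (2 ^ n / m * n) ^ (1 / p)) := by
  have hm0 : (0 : ℝ) < m := by exact_mod_cast hm
  have hn0 : (0 : ℝ) < n := by exact_mod_cast hn
  have hX : (0 : ℝ) < 2 ^ n / m * n := by positivity
  set M : ℝ := ((hypLayer d n).card : ℝ) with hM
  set K : ℝ := (2 ^ n / m * n : ℝ) ^ (1 / p) with hK
  have hK0 : 0 < K := by positivity
  have hKp : K ^ p = 2 ^ n / m * n := by
    rw [hK, ← Real.rpow_mul hX.le, one_div_mul_cancel (by linarith), Real.rpow_one]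
  have h1 : ((layerFreq d n).card * n / m : ℝ) ≤ 9 ^ d * M * K ^ p := by
    have h : ((layerFreq d n).card : ℝ) ≤ M * (9 ^ d * 2 ^ n) := by
      rw [hM]
      exact_mod_cast card_layerFreq_le d n
    rw [hKp]
    calc ((layerFreq d n).card * n / m : ℝ) ≤ M * (9 ^ d * 2 ^ n) * n / m := by gcongr
      _ = _ := by ring
  have h2 : (σ * K) ^ (2 - p) * σ ^ p * K ^ p = (σ * K) ^ 2 := by
    rw [mul_assoc, ← Real.mul_rpow hσ.le hK0.le, ← Real.rpow_add (by positivity),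
      sub_add_cancel, Real.rpow_two]
  rw [← Real.sqrt_mul (by positivity)]
  refine Real.sqrt_le_iff.2 ⟨by positivity, ?_⟩
  have h45 : (1 : ℝ) ≤ 45 ^ d := one_le_pow₀ (by norm_num)
  calc ((layerFreq d n).card * n / m : ℝ) * S
      ≤ 9 ^ d * M * K ^ p * (5 ^ d * (M * ((σ * K) ^ (2 - p) * σ ^ p))) := by
        refine (mul_le_mul_of_nonneg_left hS (by positivity)).trans ?_
        exact mul_le_mul_of_nonneg_right h1 (by positivity)
    _ = (9 * 5) ^ d * M ^ 2 * ((σ * K) ^ (2 - p) * σ ^ p * K ^ p) := by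
        rw [mul_pow]
        ring
    _ = 45 ^ d * (M ^ 2 * (σ * K) ^ 2) := by
        rw [h2]
        norm_num
        ring
    _ ≤ 45 ^ d * (45 ^ d * (M ^ 2 * (σ * K) ^ 2)) :=
        le_mul_of_one_le_left (by positivity) h45
    _ = _ := by ring

theorem card_hypLayer_mul_le {d n : ℕ} (hd : 1 ≤ d) (hn : 1 ≤ n) {x p : ℝ} (hx : 0 ≤ x) :
    ((hypLayer d n).card : ℝ) * (x * n) ^ (1 / p) ≤
      2 ^ (d - 1) * (x ^ (1 / p) * (n : ℝ) ^ ((d : ℝ) - 1 + 1 / p)) := by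
  have hn0 : (0 : ℝ) < n := by exact_mod_cast hn
  have hn1 : (1 : ℝ) ≤ n := by exact_mod_cast hn
  have h1 : ((hypLayer d n).card : ℝ) ≤ 2 ^ (d - 1) * (n : ℝ) ^ (d - 1) := by
    have h : ((hypLayer d n).card : ℝ) ≤ ((n : ℝ) + 1) ^ (d - 1) := by
      exact_mod_cast card_hypLayer_le d hd n
    rw [← mul_pow]
    exact h.trans (pow_le_pow_left₀ (by positivity) (by linarith) _)
  have h2 : (n : ℝ) ^ ((d : ℝ) - 1 + 1 / p) = (n : ℝ) ^ (d - 1) * (n : ℝ) ^ (1 / p) := by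
    rw [Real.rpow_add hn0, ← Real.rpow_natCast, Nat.cast_sub hd, Nat.cast_one]
  rw [h2, Real.mul_rpow hx hn0.le]
  calc _ ≤ 2 ^ (d - 1) * (n : ℝ) ^ (d - 1) * (x ^ (1 / p) * (n : ℝ) ^ (1 / p)) := by gcongr
    _ = _ := by ring

end KolmogorovNumbers

theorem stmt16 (d : ℕ) (hd : 1 ≤ d) (p r : ℝ) (hp : 2 ≤ p) (hr : 1 / p < r) :
    ∃ C : ℝ, 0 < C ∧ ∀ n : ℕ, 1 ≤ n → ∀ m : ℕ, 1 ≤ m → m ≤ (hypCross d n).card →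
      dK (ADelta d r (ENNReal.ofReal p) n) m ≤
        C * (2 : ℝ) ^ (-(r * n)) * ((2 ^ n : ℝ) / m) ^ (1 / p) *
          (n : ℝ) ^ ((d : ℝ) - 1 + 1 / p) := by
  obtain ⟨C, hC, hwidth⟩ := exists_submodule_trigPoly_approx d hd
  refine ⟨2 ^ (d - 1) * (56 ^ d + C * 45 ^ d), by positivity, fun n hn m hm _ => ?_⟩
  have hm0 : (0 : ℝ) < m := by exact_mod_cast hm
  have hn0 : (0 : ℝ) < n := by exact_mod_cast hn
  set σ : ℝ := (2 : ℝ) ^ (-(r * n)) with hσ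
  have hσ0 : 0 < σ := by positivity
  set K : ℝ := (2 ^ n / m * n : ℝ) ^ (1 / p) with hK
  have hK0 : 0 < K := by positivity
  obtain ⟨F, hF, hFm, happ⟩ := hwidth n hn m hm (layerFreq d n) fun k hk j =>
    abs_le_of_mem_layerFreq hk j
  set ι := (ContinuousMap.toLp ∞ (volume : Measure (Torus d)) ℂ (E := ℂ)).toLinearMap with hι
  have hle : (56 ^ d + C * 45 ^ d) * σ * ((hypLayer d n).card * K) ≤
      2 ^ (d - 1) * (56 ^ d + C * 45 ^ d) * σ * ((2 ^ n : ℝ) / m) ^ (1 / p) *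
        (n : ℝ) ^ ((d : ℝ) - 1 + 1 / p) := by
    refine (mul_le_mul_of_nonneg_left (card_hypLayer_mul_le hd hn (x := 2 ^ n / m) (p := p)
      (by positivity)) (by positivity)).trans (le_of_eq (by ring))
  refine dK_le_of_forall_exists (by positivity) (F.map ι) inferInstance
    ((Submodule.finrank_map_le ι F).trans_lt hFm) fun f hf η hη => ?_
  obtain ⟨b, hb1, hb2⟩ := exists_trigPoly_norm_sub_le (n := n) (θ := σ * K) (E := σ ^ p)
    (by positivity) hp (fun s k => (aMultd s k : ℂ) * fCoeff (f.1 : Torus d → ℂ) k)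
    (fun s k h => aMult_ne_zero_of_aMultd_mul_ne_zero h)
    fun s hs => integral_norm_Asf_rpow_le (by linarith) f hf (sum_eq_of_mem_hypLayer hs)
  obtain ⟨z, hz, hzle⟩ := happ b η hη
  refine ⟨toLinfty z, ⟨z, hz, rfl⟩, ?_⟩
  set P := ∑ s ∈ hypLayer d n, Asf s (f.1 : Torus d → ℂ)
  have hsub : ADelta d r (ENNReal.ofReal p) n f - toLinfty z = toLinfty (P - z) :=
    (map_sub ι P z).symm
  rw [hsub]
  have hsqrt := sqrt_mul_sqrt_layer_le hm hn hp hσ0 hb2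
  calc ‖toLinfty (P - z)‖ ≤ ‖P - z‖ := norm_toLinfty_le _
    _ ≤ ‖P - trigPoly (layerFreq d n) b‖ + ‖trigPoly (layerFreq d n) b - z‖ :=
        norm_sub_le_norm_sub_add_norm_sub _ _ _
    _ ≤ (hypLayer d n).card * (56 ^ d * (σ * K)) +
        (C * (45 ^ d * (hypLayer d n).card * (σ * K)) + η) := by
        refine add_le_add hb1 (hzle.trans (add_le_add ?_ le_rfl))
        rw [mul_assoc]
        exact mul_le_mul_of_nonneg_left hsqrt hC.le
    _ = (56 ^ d + C * 45 ^ d) * σ * ((hypLayer d n).card * K) + η := by ring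
    _ ≤ _ := add_le_add hle le_rfl

end
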